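/- arXiv:1702.05055 — 10 statements merged into one kernel-verified Lean document; each statement's English description precedes it below -/
import Mathlib

section
/- Let n ≥ 1 and B = ℤ^n; write d_t for the t-th standard basis tuple. Let V^{⊗n} be the ℚ-vector space with basis {v_b : b ∈ B}, with operators for each i ∈ ℕ: F_i(v_b) = Σ_t v_{b+d_t}, the sum over 1 ≤ t ≤ n with b_t = i or b_t = −i, and E_i(v_b) = Σ_t v_{b−d_t}, the sum over t with b_t = 1+i or b_t = 1−i. For σ ∈ {+1,−1}^n let B_σ = {b ∈ B : b_r > 0 whenever σ_r = +1, and b_r ≤ 0 whenever σ_r = −1}, let B_0 = {b ∈ B : b_1,…,b_n > 0}, and let b ↦ b′ be the map B → B_0 with r-th entry b_r if b_r > 0 and 1 − b_r if b_r ≤ 0. Let V_0^{⊗σ} be the ℚ-vector space with basis {v_b^σ : b ∈ B_0}, with operators for each integer i ≥ 1: F_i^σ(v_b^σ) = Σ_t v^σ_{b+σ_t d_t}, the sum over t with (b_t,σ_t) = (i,+1) or (1+i,−1), and E_i^σ(v_b^σ) = Σ_t v^σ_{b−σ_t d_t}, the sum over t with (b_t,σ_t) = (1+i,+1) or (i,−1).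 Define the linear map pr_σ : V^{⊗n} → V_0^{⊗σ} by pr_σ(v_b) = v^σ_{b′} if b ∈ B_σ and pr_σ(v_b) = 0 otherwise. Then the map Σ_σ pr_σ : V^{⊗n} → ⊕_{σ∈{+1,−1}^n} V_0^{⊗σ} is a linear isomorphism, and for every integer i ≥ 1 and every σ one has pr_σ ∘ F_i = F_i^σ ∘ pr_σ and pr_σ ∘ E_i = E_i^σ ∘ pr_σ. -/
/-!
STATEMENT 1: restricted to the operators indexed by integers i ≥ 1 (i.e. to
sl_{+∞}), the tensor power V^{⊗n} is isomorphic, via the projections pr_σ, to the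
direct sum over all sign sequences σ of the spaces V₀^{⊗σ}.
-/

open Finsupp LinearMap

open scoped Classical

/-- The space `V^{⊗n}` with monomial basis `{v_b : b ∈ ℤ^n}`. -/
abbrev VT (n : ℕ) : Type := (Fin n → ℤ) →₀ ℚ

/-- `B₀`: tuples with all entries positive, indexing the basis of `V₀^{⊗σ}`. -/
abbrev PosTuple (n : ℕ) : Type := {b : Fin n → ℤ // ∀ r, 0 < b r}

/-- The space `V₀^{⊗σ}` with monomial basis `{v_b^σ : b ∈ B₀}`. -/
abbrev WT (n : ℕ) : Type := PosTuple n →₀ ℚ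

/-- `d_t`, the t-th standard basis tuple of `ℤ^n`. -/
def dvec (n : ℕ) (t : Fin n) : Fin n → ℤ := fun r => if r = t then 1 else 0

/-- `F_i` on `V^{⊗n}`: `F_i v_b = Σ_t v_{b+d_t}`, summed over `t` with `b t = ±i`. -/
noncomputable def FF (n : ℕ) (i : ℕ) : VT n →ₗ[ℚ] VT n :=
  Finsupp.lsum ℚ fun b : Fin n → ℤ =>
    LinearMap.toSpanSingleton ℚ (VT n)
      (∑ t ∈ Finset.univ.filter (fun t : Fin n => b t = (i : ℤ) ∨ b t = -(i : ℤ)),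
        Finsupp.single (b + dvec n t) 1)

/-- `E_i` on `V^{⊗n}`: `E_i v_b = Σ_t v_{b-d_t}`, summed over `t` with `b t = 1 ± i`. -/
noncomputable def EE (n : ℕ) (i : ℕ) : VT n →ₗ[ℚ] VT n :=
  Finsupp.lsum ℚ fun b : Fin n → ℤ =>
    LinearMap.toSpanSingleton ℚ (VT n)
      (∑ t ∈ Finset.univ.filter (fun t : Fin n => b t = 1 + (i : ℤ) ∨ b t = 1 - (i : ℤ)),
        Finsupp.single (b - dvec n t) 1)

/-- `F_i^σ` on `V₀^{⊗σ}` for `i ≥ 1`: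
`F_i^σ v_b^σ = Σ_t v^σ_{b+σ_t d_t}`, summed over `t` with `(b_t,σ_t) = (i,+1)` or `(1+i,−1)`. -/
noncomputable def F0 (n : ℕ) (σ : Fin n → ℤ) (i : ℤ) (hi : 1 ≤ i) : WT n →ₗ[ℚ] WT n :=
  Finsupp.lsum ℚ fun b : PosTuple n =>
    ∑ t : Fin n,
      if h : (b.1 t = i ∧ σ t = 1) ∨ (b.1 t = 1 + i ∧ σ t = -1) then
        LinearMap.toSpanSingleton ℚ (WT n)
          (Finsupp.single
            ⟨b.1 + σ t • dvec n t, by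
              intro r
              have hb := b.2 r
              have hbt := b.2 t
              simp only [Pi.add_apply, Pi.smul_apply, dvec, smul_eq_mul]
              by_cases hr : r = t
              · subst hr
                rcases h with ⟨h1, h2⟩ | ⟨h1, h2⟩ <;> simp [h1, h2] <;> omega
              · simp only [if_neg hr, mul_zero, add_zero]; exact hb⟩ 1)
      else 0

/-- `E_i^σ` on `V₀^{⊗σ}` for `i ≥ 1`:
`E_i^σ v_b^σ = Σ_t v^σ_{b−σ_t d_t}`, summed over `t` with `(b_t,σ_t) = (1+i,+1)` or `(i,−1)`. -/
noncomputable def E0 (n : ℕ) (σ : Fin n → ℤ) (i : ℤ) (hi : 1 ≤ i) : WT n →ₗ[ℚ] WT n :=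
  Finsupp.lsum ℚ fun b : PosTuple n =>
    ∑ t : Fin n,
      if h : (b.1 t = 1 + i ∧ σ t = 1) ∨ (b.1 t = i ∧ σ t = -1) then
        LinearMap.toSpanSingleton ℚ (WT n)
          (Finsupp.single
            ⟨b.1 - σ t • dvec n t, by
              intro r
              have hb := b.2 r
              have hbt := b.2 t
              simp only [Pi.sub_apply, Pi.smul_apply, dvec, smul_eq_mul]
              by_cases hr : r = t
              · subst hr
                rcases h with ⟨h1, h2⟩ | ⟨h1, h2⟩ <;> simp [h1, h2] <;> omega
              · simp only [if_neg hr, mul_zero, sub_zero]; exact hb⟩ 1)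
      else 0

/-- The set `B_σ`. -/
def Bsig {n : ℕ} (σ : Fin n → ℤ) : Set (Fin n → ℤ) :=
  {b | ∀ r, (σ r = 1 → 0 < b r) ∧ (σ r = -1 → b r ≤ 0)}

/-- The map `b ↦ b′`, with r-th entry `b_r` if `b_r > 0` and `1 − b_r` otherwise. -/
def primeMap {n : ℕ} (b : Fin n → ℤ) : Fin n → ℤ := fun r => if 0 < b r then b r else 1 - b r

/-- The projection `pr_σ : V^{⊗n} → V₀^{⊗σ}`, `v_b ↦ v^σ_{b′}` if `b ∈ B_σ`, else `0`. -/
noncomputable def prSig (n : ℕ) (σ : Fin n → ℤ) : VT n →ₗ[ℚ] WT n :=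
  Finsupp.lsum ℚ fun b : Fin n → ℤ =>
    if b ∈ Bsig σ then
      LinearMap.toSpanSingleton ℚ (WT n)
        (Finsupp.single ⟨primeMap b, by intro r; unfold primeMap; split <;> omega⟩ 1)
    else 0

/-- Sign sequences `σ ∈ {+1,−1}^n`. -/
abbrev Sgn (n : ℕ) : Type := {σ : Fin n → ℤ // ∀ r, σ r = 1 ∨ σ r = -1}

theorem primeMap_pos {n : ℕ} (b : Fin n → ℤ) (r : Fin n) : 0 < primeMap b r := by
  unfold primeMap
  split <;> omega

/-- The tuple in `B_σ` whose image under `b ↦ b′` is `p`. -/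
def unprime {n : ℕ} (σ p : Fin n → ℤ) : Fin n → ℤ := fun r => if σ r = 1 then p r else 1 - p r

/-- The sign sequence `σ` with `b ∈ B_σ`. -/
def signOf {n : ℕ} (b : Fin n → ℤ) : Sgn n :=
  ⟨fun r => if 0 < b r then 1 else -1, fun r => by
    by_cases h : 0 < b r <;> simp [h]⟩

/-- The decomposition `B ≃ ⨆_σ B_σ ≃ ⨆_σ B₀`. -/
def tupleEquiv (n : ℕ) : (Fin n → ℤ) ≃ (_ : Sgn n) × PosTuple n where
  toFun b := ⟨signOf b, primeMap b, primeMap_pos b⟩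
  invFun q := unprime q.1.1 q.2.1
  left_inv b := by
    funext r
    by_cases h : 0 < b r <;> simp [unprime, signOf, primeMap, h]
  right_inv := by
    rintro ⟨⟨σ, hσ⟩, p, hp⟩
    have hs : signOf (unprime σ p) = ⟨σ, hσ⟩ := by
      ext r
      have := hp r
      rcases hσ r with h | h <;> simp [signOf, unprime, h] <;> omega
    have hq : primeMap (unprime σ p) = p := by
      funext r
      have := hp r
      rcases hσ r with h | h <;> simp [primeMap, unprime, h] <;> omega
    simp only [hs, hq]

theorem prSig_single {n : ℕ} (σ b : Fin n → ℤ) (c : ℚ) :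
    prSig n σ (single b c) =
      if b ∈ Bsig σ then single ⟨primeMap b, primeMap_pos b⟩ c else 0 := by
  by_cases h : b ∈ Bsig σ <;> simp [prSig, h]

theorem mem_Bsig_iff {n : ℕ} (σ : Sgn n) (b : Fin n → ℤ) : b ∈ Bsig σ.1 ↔ signOf b = σ := by
  simp only [Bsig, Set.mem_ofPred_eq, signOf, Subtype.ext_iff, funext_iff]
  refine forall_congr' fun r => ?_
  rcases σ.2 r with h | h <;> by_cases hb : 0 < b r <;> simp [h, hb] <;> omega

theorem prSig_apply {n : ℕ} (σ : Sgn n) (f : VT n) (p : PosTuple n) :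
    prSig n σ.1 f p = f ((tupleEquiv n).symm ⟨σ, p⟩) := by
  induction f using Finsupp.induction_linear with
  | zero => simp
  | add f g hf hg => simp [hf, hg]
  | single b c =>
    simp only [prSig_single, Finsupp.single_apply, Equiv.eq_symm_apply]
    simp only [mem_Bsig_iff, tupleEquiv, Equiv.coe_fn_mk, Sigma.mk.injEq, heq_eq_eq]
    by_cases h : signOf b = σ <;> simp [h, Finsupp.single_apply]

theorem sign_cases_of_mem_Bsig {n : ℕ} {σ b : Fin n → ℤ} (hσ : ∀ r, σ r = 1 ∨ σ r = -1)
    (hb : b ∈ Bsig σ) (r : Fin n) :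
    (σ r = 1 ∧ 0 < b r ∧ primeMap b r = b r) ∨
      (σ r = -1 ∧ b r ≤ 0 ∧ primeMap b r = 1 - b r) := by
  rcases hσ r with h | h
  · have := (hb r).1 h
    exact Or.inl ⟨h, this, if_pos this⟩
  · have := (hb r).2 h
    exact Or.inr ⟨h, this, if_neg this.not_gt⟩

instance finite_sgn (n : ℕ) : Finite (Sgn n) := by
  refine Finite.of_injective (fun σ : Sgn n => fun r => decide (σ.1 r = 1)) fun σ τ h => ?_
  ext r
  have := congrFun h r
  rcases σ.2 r with h1 | h1 <;> rcases τ.2 r with h2 | h2 <;> simp_all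

theorem pi_prSig_bijective (n : ℕ) :
    Function.Bijective
      (LinearMap.pi (fun σ : Sgn n => prSig n σ.1) : VT n →ₗ[ℚ] Sgn n → WT n) := by
  constructor
  · intro f g h
    ext b
    have h' := DFunLike.congr_fun (congrFun h (tupleEquiv n b).1) (tupleEquiv n b).2
    simpa [prSig_apply] using h'
  · intro g
    have := Fintype.ofFinite (Sgn n)
    refine ⟨Finsupp.equivMapDomain (tupleEquiv n).symm
      (Finsupp.sigmaFinsuppEquivPiFinsupp.symm g), ?_⟩
    funext σ
    ext p
    simp [prSig_apply, Finsupp.equivMapDomain_apply, Finsupp.sigmaFinsuppEquivPiFinsupp]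

/-- Raising an entry `±i` with `i ≥ 1` does not change membership in `B_σ`. -/
theorem add_dvec_mem_Bsig {n : ℕ} {σ b : Fin n → ℤ} {i : ℤ} (hi : 1 ≤ i) {t : Fin n}
    (ht : b t = i ∨ b t = -i) : b + dvec n t ∈ Bsig σ ↔ b ∈ Bsig σ := by
  refine forall_congr' fun r => ?_
  by_cases hr : r = t
  · subst hr
    simp only [Pi.add_apply, dvec, if_true]
    have h1 : 0 < b r + 1 ↔ 0 < b r := by omega
    have h2 : b r + 1 ≤ 0 ↔ b r ≤ 0 := by omega
    rw [h1, h2]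
  · simp [dvec, hr]

/-- Lowering an entry `1 ± i` with `i ≥ 1` does not change membership in `B_σ`. -/
theorem sub_dvec_mem_Bsig {n : ℕ} {σ b : Fin n → ℤ} {i : ℤ} (hi : 1 ≤ i) {t : Fin n}
    (ht : b t = 1 + i ∨ b t = 1 - i) : b - dvec n t ∈ Bsig σ ↔ b ∈ Bsig σ := by
  refine forall_congr' fun r => ?_
  by_cases hr : r = t
  · subst hr
    simp only [Pi.sub_apply, dvec, if_true]
    have h1 : 0 < b r - 1 ↔ 0 < b r := by omega
    have h2 : b r - 1 ≤ 0 ↔ b r ≤ 0 := by omega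
    rw [h1, h2]
  · simp [dvec, hr]

theorem prSig_comp_FF {n : ℕ} {σ : Fin n → ℤ} (hσ : ∀ r, σ r = 1 ∨ σ r = -1) (i : ℕ)
    (hi : 1 ≤ (i : ℤ)) : prSig n σ ∘ₗ FF n i = F0 n σ i hi ∘ₗ prSig n σ := by
  refine Finsupp.lhom_ext' fun b => LinearMap.ext_ring ?_
  simp only [LinearMap.comp_apply, Finsupp.lsingle_apply, prSig_single]
  simp only [FF, Finsupp.lsum_single, LinearMap.toSpanSingleton_apply, one_smul, map_sum,
    prSig_single]
  by_cases hb : b ∈ Bsig σ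
  · rw [if_pos hb]
    simp only [F0, Finsupp.lsum_single, LinearMap.sum_apply]
    rw [Finset.sum_filter]
    refine Finset.sum_congr rfl fun t _ => ?_
    have hbt := sign_cases_of_mem_Bsig hσ hb t
    have hiff : (b t = i ∨ b t = -i) ↔
        (primeMap b t = i ∧ σ t = 1) ∨ (primeMap b t = 1 + i ∧ σ t = -1) := by
      omega
    by_cases ht : b t = i ∨ b t = -i
    · rw [if_pos ht, dif_pos (hiff.1 ht), if_pos ((add_dvec_mem_Bsig hi ht).2 hb),
        LinearMap.toSpanSingleton_apply, one_smul]
      congr 1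
      refine Subtype.ext (funext fun r => ?_)
      by_cases hr : r = t
      · subst hr
        have hbt' := sign_cases_of_mem_Bsig hσ ((add_dvec_mem_Bsig hi ht).2 hb) r
        simp only [dvec, Pi.add_apply, Pi.smul_apply, if_true, smul_eq_mul, mul_one] at hbt' ⊢
        omega
      · simp [primeMap, dvec, hr]
    · rw [if_neg ht, dif_neg (mt hiff.2 ht), LinearMap.zero_apply]
  · rw [if_neg hb, map_zero]
    refine Finset.sum_eq_zero fun t ht => if_neg ?_
    rwa [add_dvec_mem_Bsig hi (Finset.mem_filter.1 ht).2]

theorem prSig_comp_EE {n : ℕ} {σ : Fin n → ℤ} (hσ : ∀ r, σ r = 1 ∨ σ r = -1) (i : ℕ)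
    (hi : 1 ≤ (i : ℤ)) : prSig n σ ∘ₗ EE n i = E0 n σ i hi ∘ₗ prSig n σ := by
  refine Finsupp.lhom_ext' fun b => LinearMap.ext_ring ?_
  simp only [LinearMap.comp_apply, Finsupp.lsingle_apply, prSig_single]
  simp only [EE, Finsupp.lsum_single, LinearMap.toSpanSingleton_apply, one_smul, map_sum,
    prSig_single]
  by_cases hb : b ∈ Bsig σ
  · rw [if_pos hb]
    simp only [E0, Finsupp.lsum_single, LinearMap.sum_apply]
    rw [Finset.sum_filter]
    refine Finset.sum_congr rfl fun t _ => ?_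
    have hbt := sign_cases_of_mem_Bsig hσ hb t
    have hiff : (b t = 1 + i ∨ b t = 1 - i) ↔
        (primeMap b t = 1 + i ∧ σ t = 1) ∨ (primeMap b t = i ∧ σ t = -1) := by
      omega
    by_cases ht : b t = 1 + i ∨ b t = 1 - i
    · rw [if_pos ht, dif_pos (hiff.1 ht), if_pos ((sub_dvec_mem_Bsig hi ht).2 hb),
        LinearMap.toSpanSingleton_apply, one_smul]
      congr 1
      refine Subtype.ext (funext fun r => ?_)
      by_cases hr : r = t
      · subst hr
        have hbt' := sign_cases_of_mem_Bsig hσ ((sub_dvec_mem_Bsig hi ht).2 hb) r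
        simp only [dvec, Pi.sub_apply, Pi.smul_apply, if_true, smul_eq_mul, mul_one] at hbt' ⊢
        omega
      · simp [primeMap, dvec, hr]
    · rw [if_neg ht, dif_neg (mt hiff.2 ht), LinearMap.zero_apply]
  · rw [if_neg hb, map_zero]
    refine Finset.sum_eq_zero fun t ht => if_neg ?_
    rwa [sub_dvec_mem_Bsig hi (Finset.mem_filter.1 ht).2]

theorem statement_1 (n : ℕ) (hn : 1 ≤ n) :
    Function.Bijective (LinearMap.pi (fun σ : Sgn n => prSig n σ.1) : VT n →ₗ[ℚ] Sgn n → WT n) ∧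
    ∀ σ : Fin n → ℤ, (∀ r, σ r = 1 ∨ σ r = -1) →
      ∀ (i : ℕ) (hi : 1 ≤ (i : ℤ)),
        prSig n σ ∘ₗ FF n i = F0 n σ (i : ℤ) hi ∘ₗ prSig n σ ∧
        prSig n σ ∘ₗ EE n i = E0 n σ (i : ℤ) hi ∘ₗ prSig n σ := by
  exact ⟨pi_prSig_bijective n, fun σ hσ i hi => ⟨prSig_comp_FF hσ i hi, prSig_comp_EE hσ i hi⟩⟩
end

section
/- Let n ≥ 1 and B = ℤ^n. For i ∈ ℕ and 1 ≤ s ≤ n set N_{[1,s]}(b,i) := #{1 ≤ r ≤ s : b_r > i} − #{1 ≤ r ≤ s : b_r ≤ −i}. Then for a, b ∈ B one has a ⪯ b (in the sp_{2∞}-Bruhat order) if and only if: (i) N_{[1,s]}(a,0) ≡ N_{[1,s]}(b,0) (mod 2) for each s = 1,…,n−1; (ii) N_{[1,s]}(a,i) ≤ N_{[1,s]}(b,i) for all i ∈ ℕ and all s = 1,…,n−1; and (iii) N_{[1,n]}(a,i) = N_{[1,n]}(b,i) for all i ∈ ℕ. -/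
/-!
STATEMENT 3: counting characterization of the sp_{2∞}-Bruhat order ⪯ on ℤ^n.
-/

open Finsupp

/-- The weight lattice of `sp_{2∞}`: finitely supported functions `ℕ → ℤ`. -/
abbrev PC : Type := ℕ →₀ ℤ

/-- `ε_i`. -/
noncomputable def epsC (i : ℕ) : PC := Finsupp.single i 1

/-- Simple roots: `α_0 = −2ε_0` and `α_i = ε_{i−1} − ε_i` for `i ≥ 1`. -/
noncomputable def alphaC (i : ℕ) : PC := if i = 0 then -(2 • epsC 0) else epsC (i - 1) - epsC i

/-- Dominance order: `λ ⊵ μ` iff `λ − μ` is a finite ℕ-linear combination of the `α_i`. -/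
def DomC (lam mu : PC) : Prop :=
  ∃ c : ℕ →₀ ℕ, lam - mu = c.sum fun i k => (k : ℤ) • alphaC i

/-- Partial sum `β_1 + ⋯ + β_s` (entries with index `< s` in 0-based indexing). -/
noncomputable def psumC {n : ℕ} (β : Fin n → PC) (s : ℕ) : PC :=
  ∑ r ∈ Finset.univ.filter (fun r : Fin n => (r : ℕ) < s), β r

/-- Inverse dominance order on `PC^n`. -/
def InvDomC {n : ℕ} (β γ : Fin n → PC) : Prop :=
  psumC β n = psumC γ n ∧ ∀ s : ℕ, 1 ≤ s → s ≤ n → DomC (psumC β s) (psumC γ s)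

/-- `WT(b)`: `wt_r(b) = ε_{b_r−1}` if `b_r > 0` and `−ε_{−b_r}` if `b_r ≤ 0`. -/
noncomputable def wtC {n : ℕ} (b : Fin n → ℤ) : Fin n → PC :=
  fun r => if 0 < b r then epsC (b r - 1).toNat else -epsC (-(b r)).toNat

/-- The `sp_{2∞}`-Bruhat order: `a ⪯ b` iff `WT(a) ⪯ WT(b)` in inverse dominance order. -/
def BruhatC {n : ℕ} (a b : Fin n → ℤ) : Prop := InvDomC (wtC a) (wtC b)

/-- `N_{[1,s]}(b,i) = #{r ≤ s : b_r > i} − #{r ≤ s : b_r ≤ −i}`. -/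
def NC {n : ℕ} (b : Fin n → ℤ) (i : ℤ) (s : ℕ) : ℤ :=
  ((Finset.univ.filter fun r : Fin n => (r : ℕ) < s ∧ i < b r).card : ℤ) -
  ((Finset.univ.filter fun r : Fin n => (r : ℕ) < s ∧ b r ≤ -i).card : ℤ)

/-- The functional `λ ↦ ∑_{j ≥ i} λ_j`. -/
noncomputable def tailC (i : ℕ) : PC →+ ℤ :=
  Finsupp.liftAddHom fun j => if i ≤ j then AddMonoidHom.id ℤ else 0

theorem tailC_single (i j : ℕ) (k : ℤ) :
    tailC i (Finsupp.single j k) = if i ≤ j then k else 0 := by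
  rw [tailC, Finsupp.liftAddHom_apply_single]
  split_ifs <;> rfl

theorem tailC_eps (i j : ℕ) : tailC i (epsC j) = if i ≤ j then 1 else 0 :=
  tailC_single i j 1

theorem tailC_alpha (i j : ℕ) :
    tailC i (alphaC j) = if j = i then -(if i = 0 then 2 else 1) else 0 := by
  unfold alphaC
  split_ifs <;> simp only [map_neg, map_nsmul, map_sub, tailC_eps] <;> grind

theorem tailC_sub_tailC_succ (i : ℕ) (lam : PC) : tailC i lam - tailC (i + 1) lam = lam i := by
  induction lam using Finsupp.induction_linear with
  | zero => simp
  | add f g hf hg =>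
    rw [map_add, map_add, Finsupp.add_apply]
    linarith
  | single j k =>
    rw [tailC_single, tailC_single, Finsupp.single_apply]
    grind

theorem ext_tailC {lam mu : PC} (h : ∀ i, tailC i lam = tailC i mu) : lam = mu := by
  ext i
  rw [← tailC_sub_tailC_succ, ← tailC_sub_tailC_succ, h, h]

theorem finite_setOf_tailC_ne_zero (lam : PC) : {i | tailC i lam ≠ 0}.Finite := by
  induction lam using Finsupp.induction_linear with
  | zero => simp
  | add f g hf hg =>
    refine (hf.union hg).subset fun i hi => ?_
    simp only [Set.mem_ofPred_eq, Set.mem_union, map_add] at hi ⊢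
    grind
  | single j k =>
    refine (Set.finite_Iic j).subset fun i hi => ?_
    simp only [Set.mem_ofPred_eq, tailC_single, Set.mem_Iic] at hi ⊢
    grind

theorem tailC_sum_alpha (i : ℕ) (c : ℕ →₀ ℕ) :
    tailC i (c.sum fun j k => (k : ℤ) • alphaC j) = -((if i = 0 then 2 else 1) * (c i : ℤ)) := by
  rw [map_finsuppSum]
  simp only [map_zsmul, tailC_alpha, smul_eq_mul, mul_ite, mul_zero]
  rw [Finsupp.sum_ite_eq']
  grind

theorem domC_iff (lam mu : PC) :
    DomC lam mu ↔
      tailC 0 lam % 2 = tailC 0 mu % 2 ∧ ∀ i, tailC i lam ≤ tailC i mu := by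
  constructor
  · rintro ⟨c, hc⟩
    have h (i : ℕ) :
        tailC i lam - tailC i mu = -((if i = 0 then 2 else 1) * (c i : ℤ)) := by
      rw [← map_sub, hc, tailC_sum_alpha]
    refine ⟨?_, fun i => ?_⟩
    · have := h 0
      rw [if_pos rfl] at this
      omega
    · have := h i
      split_ifs at this <;> omega
  · rintro ⟨h₀, h⟩
    have hfin : (Function.support fun i : ℕ =>
        (tailC i (mu - lam) / (if i = 0 then 2 else 1)).toNat).Finite := by
      refine (finite_setOf_tailC_ne_zero (mu - lam)).subset fun i hi h0 => hi ?_
      simp [h0]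
    refine ⟨Finsupp.ofSupportFinite _ hfin, ext_tailC fun i => ?_⟩
    rw [tailC_sum_alpha, Finsupp.ofSupportFinite_coe, map_sub, map_sub]
    have := h i
    split_ifs with hi
    · subst hi
      omega
    · omega

theorem domC_refl (lam : PC) : DomC lam lam := ⟨0, by simp⟩

theorem tailC_wtC {n : ℕ} (b : Fin n → ℤ) (i : ℕ) (r : Fin n) :
    tailC i (wtC b r) = (if (i : ℤ) < b r then 1 else 0) - (if b r ≤ -(i : ℤ) then 1 else 0) := by
  unfold wtC
  split_ifs <;> simp only [map_neg, tailC_eps] <;> split_ifs <;> omega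

theorem tailC_psumC_wtC {n : ℕ} (b : Fin n → ℤ) (i s : ℕ) :
    tailC i (psumC (wtC b) s) = NC b i s := by
  simp only [psumC, NC, map_sum, tailC_wtC, Finset.sum_sub_distrib, Finset.sum_boole,
    Finset.filter_filter]

theorem statement_3 (n : ℕ) (hn : 1 ≤ n) (a b : Fin n → ℤ) :
    BruhatC a b ↔
      ((∀ s : ℕ, 1 ≤ s → s < n → NC a 0 s % 2 = NC b 0 s % 2) ∧
       (∀ i : ℕ, ∀ s : ℕ, 1 ≤ s → s < n → NC a (i : ℤ) s ≤ NC b (i : ℤ) s) ∧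
       (∀ i : ℕ, NC a (i : ℤ) n = NC b (i : ℤ) n)) := by
  have hdom (s : ℕ) : DomC (psumC (wtC a) s) (psumC (wtC b) s) ↔
      NC a 0 s % 2 = NC b 0 s % 2 ∧ ∀ i : ℕ, NC a i s ≤ NC b i s := by
    simp only [domC_iff, tailC_psumC_wtC, Nat.cast_zero]
  constructor
  · rintro ⟨hn', h⟩
    refine ⟨fun s h1 hs => ((hdom s).1 (h s h1 hs.le)).1,
      fun i s h1 hs => ((hdom s).1 (h s h1 hs.le)).2 i, fun i => ?_⟩
    rw [← tailC_psumC_wtC, hn', tailC_psumC_wtC]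
  · rintro ⟨hpar, hle, heq⟩
    have hn' : psumC (wtC a) n = psumC (wtC b) n :=
      ext_tailC fun i => by rw [tailC_psumC_wtC, tailC_psumC_wtC, heq]
    refine ⟨hn', fun s h1 hs => ?_⟩
    rcases hs.lt_or_eq with hs | rfl
    · exact (hdom s).2 ⟨hpar s h1 hs, fun i => hle i s h1 hs⟩
    · exact hn' ▸ domC_refl _
end

section
/- Let n ≥ 1, B = ℤ^n, and fix σ ∈ {+1,−1}^n. Let B_σ = {b ∈ B : b_r > 0 whenever σ_r = +1, and b_r ≤ 0 whenever σ_r = −1}, let B_0 = {b ∈ B : b_1,…,b_n > 0}, and let b ↦ b′ be the map whose r-th entry is b_r if b_r > 0 and 1 − b_r if b_r ≤ 0. Then b ↦ b′ restricts to a bijection B_σ → B_0, and for all a, b ∈ B_σ one has a ⪯ b (sp_{2∞}-Bruhat order) if and only if a′ ⪯_σ b′ (sl_∞-Bruhat order with respect to σ); i.e. it is a poset isomorphism (B_σ, ⪯) ≅ (B_0, ⪯_σ). -/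
/-!
STATEMENT 4: `b ↦ b′` is a poset isomorphism `(B_σ, ⪯) ≅ (B_0, ⪯_σ)` between the
sp_{2∞}-Bruhat order on B_σ and the sl_∞-Bruhat order on B_0.
-/

open Finsupp

/-! sl_∞-Bruhat order. -/

abbrev PA : Type := ℤ →₀ ℤ

noncomputable def epsA (i : ℤ) : PA := Finsupp.single i 1

noncomputable def alphaA (i : ℤ) : PA := epsA i - epsA (i + 1)

def DomA (lam mu : PA) : Prop :=
  ∃ c : ℤ →₀ ℕ, lam - mu = c.sum fun i k => (k : ℤ) • alphaA i

noncomputable def psumA {n : ℕ} (β : Fin n → PA) (s : ℕ) : PA :=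
  ∑ r ∈ Finset.univ.filter (fun r : Fin n => (r : ℕ) < s), β r

def InvDomA {n : ℕ} (β γ : Fin n → PA) : Prop :=
  psumA β n = psumA γ n ∧ ∀ s : ℕ, 1 ≤ s → s ≤ n → DomA (psumA β s) (psumA γ s)

noncomputable def wtA {n : ℕ} (σ b : Fin n → ℤ) : Fin n → PA := fun r => σ r • epsA (b r)

def BruhatA {n : ℕ} (σ a b : Fin n → ℤ) : Prop := InvDomA (wtA σ a) (wtA σ b)

/-- `B_0`: all entries positive. -/
def B0set (n : ℕ) : Set (Fin n → ℤ) := {b | ∀ r, 0 < b r}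

/-- The additive map `ε_i ↦ ε_{i+1}` from the weights indexed by `ℕ` to those indexed by `ℤ`. -/
noncomputable def shiftEmb : PC →+ PA :=
  Finsupp.mapDomain.addMonoidHom fun i : ℕ => (i : ℤ) + 1

lemma shiftEmb_injective : Function.Injective shiftEmb :=
  Finsupp.mapDomain_injective fun i j h => by simpa using h

lemma shiftEmb_epsC (i : ℕ) : shiftEmb (epsC i) = epsA ((i : ℤ) + 1) :=
  Finsupp.mapDomain_single

lemma shiftEmb_alphaC {i : ℕ} (hi : i ≠ 0) : shiftEmb (alphaC i) = alphaA i := by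
  obtain ⟨j, rfl⟩ := Nat.exists_eq_succ_of_ne_zero hi
  simp [alphaC, alphaA, shiftEmb_epsC]

lemma shiftEmb_apply_of_nonpos (x : PC) {j : ℤ} (hj : j ≤ 0) : shiftEmb x j = 0 :=
  Finsupp.mapDomain_of_notMem_range x j (by rintro ⟨i, hi⟩; dsimp only at hi; omega)

lemma shiftEmb_psumC {n : ℕ} (β : Fin n → PC) (s : ℕ) :
    shiftEmb (psumC β s) = psumA (fun r => shiftEmb (β r)) s :=
  map_sum ..

/-- The sum of the coefficients of a weight. -/
noncomputable def coeffSum : PC →+ ℤ := Finsupp.liftAddHom fun _ => AddMonoidHom.id ℤ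

lemma coeffSum_epsC (i : ℕ) : coeffSum (epsC i) = 1 := by simp [coeffSum, epsC]

lemma coeffSum_alphaC (i : ℕ) : coeffSum (alphaC i) = if i = 0 then -2 else 0 := by
  unfold alphaC
  split_ifs <;> simp [coeffSum_epsC]

lemma coeffSum_sum_alphaC (c : ℕ →₀ ℕ) :
    coeffSum (c.sum fun i k => (k : ℤ) • alphaC i) = -2 * c 0 := by
  rw [map_finsuppSum, Finsupp.sum_eq_single 0]
  · simp [coeffSum_alphaC, mul_comm]
  · intro i _ hi
    simp [coeffSum_alphaC, hi]
  · simp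

lemma shiftEmb_sum_alphaC (c : ℕ →₀ ℕ) (hc : c 0 = 0) :
    shiftEmb (c.sum fun i k => (k : ℤ) • alphaC i) =
      (c.mapDomain ((↑) : ℕ → ℤ)).sum fun i k => (k : ℤ) • alphaA i := by
  rw [Finsupp.sum_mapDomain_index (by simp) (by simp [add_smul]), map_finsuppSum]
  refine Finsupp.sum_congr fun i hi => ?_
  rw [map_zsmul, shiftEmb_alphaC]
  rintro rfl
  exact Finsupp.mem_support_iff.1 hi hc

lemma sum_alphaA_apply (c : ℤ →₀ ℕ) (j : ℤ) :
    (c.sum fun i k => (k : ℤ) • alphaA i) j = (c j : ℤ) - c (j - 1) := by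
  induction c using Finsupp.induction_linear with
  | zero => simp
  | add f g hf hg =>
    rw [Finsupp.sum_add_index' (by simp) (by simp [add_smul]), Finsupp.add_apply, hf, hg]
    simp only [Finsupp.add_apply]
    push_cast
    ring
  | single i k =>
    rw [Finsupp.sum_single_index (by simp)]
    simp only [alphaA, epsA, Finsupp.smul_apply, Finsupp.sub_apply, Finsupp.single_apply,
      smul_eq_mul]
    split_ifs <;> omega

lemma eq_zero_of_forall_nonpos_eq_pred (c : ℤ →₀ ℕ) (h : ∀ j ≤ 0, c j = c (j - 1)) {j : ℤ}
    (hj : j ≤ 0) : c j = 0 := by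
  have hshift (m : ℕ) : c (j - m) = c j := by
    induction m with
    | zero => simp
    | succ m ih =>
      rw [← ih, h (j - m) (by omega)]
      congr 1
      push_cast
      ring
  by_contra hne
  have hinj : Function.Injective fun m : ℕ => j - (m : ℤ) := fun a b hab => by
    dsimp only at hab
    omega
  refine Set.infinite_range_of_injective hinj (c.support.finite_toSet.subset ?_)
  rintro _ ⟨m, rfl⟩
  simpa [hshift] using hne

lemma domC_iff_domA_shiftEmb {x y : PC} (hxy : coeffSum x = coeffSum y) :
    DomC x y ↔ DomA (shiftEmb x) (shiftEmb y) := by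
  constructor
  · rintro ⟨c, hc⟩
    have hc0 : c 0 = 0 := by
      have := coeffSum_sum_alphaC c
      rw [← hc, map_sub, hxy, sub_self] at this
      omega
    exact ⟨_, by rw [← map_sub, hc, shiftEmb_sum_alphaC c hc0]⟩
  · rintro ⟨c, hc⟩
    have hzero {j : ℤ} (hj : j ≤ 0) : c j = 0 := by
      refine eq_zero_of_forall_nonpos_eq_pred c (fun i hi => ?_) hj
      have := sum_alphaA_apply c i
      rw [← hc, ← map_sub, shiftEmb_apply_of_nonpos _ hi] at this
      omega
    have hcast : Function.Injective ((↑) : ℕ → ℤ) := Nat.cast_injective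
    have hmap : (c.comapDomain _ hcast.injOn).mapDomain ((↑) : ℕ → ℤ) = c := by
      refine Finsupp.mapDomain_comapDomain _ hcast c fun i hi => ?_
      refine ⟨i.toNat, Int.toNat_of_nonneg ?_⟩
      by_contra hneg
      exact Finsupp.mem_support_iff.1 hi (hzero (by omega))
    refine ⟨c.comapDomain _ hcast.injOn, shiftEmb_injective ?_⟩
    rw [shiftEmb_sum_alphaC _ (by simpa using hzero le_rfl), hmap, map_sub, hc]

lemma shiftEmb_wtC {n : ℕ} {σ b : Fin n → ℤ} (hσ : ∀ r, σ r = 1 ∨ σ r = -1) (hb : b ∈ Bsig σ)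
    (r : Fin n) : shiftEmb (wtC b r) = wtA σ (primeMap b) r := by
  rcases hσ r with h | h
  · have hpos := (hb r).1 h
    simp only [wtC, wtA, primeMap, hpos, if_true, h, shiftEmb_epsC, one_smul]
    congr 1
    omega
  · have hneg := (hb r).2 h
    simp only [wtC, wtA, primeMap, not_lt.2 hneg, if_false, h, map_neg, shiftEmb_epsC, neg_smul,
      one_smul]
    congr 2
    omega

lemma coeffSum_wtC {n : ℕ} {σ b : Fin n → ℤ} (hσ : ∀ r, σ r = 1 ∨ σ r = -1) (hb : b ∈ Bsig σ)
    (r : Fin n) : coeffSum (wtC b r) = σ r := by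
  rcases hσ r with h | h
  · simp [wtC, (hb r).1 h, h, coeffSum_epsC]
  · simp [wtC, not_lt.2 ((hb r).2 h), h, coeffSum_epsC]

lemma primeMap_bijOn {n : ℕ} {σ : Fin n → ℤ} (hσ : ∀ r, σ r = 1 ∨ σ r = -1) :
    Set.BijOn primeMap (Bsig σ) (B0set n) := by
  refine ⟨fun b _ r => ?_, fun a ha b hb hab => funext fun r => ?_, fun b hb => ?_⟩
  · unfold primeMap
    split_ifs <;> omega
  · have h := congrFun hab r
    have har := ha r
    have hbr := hb r
    have hσr := hσ r
    unfold primeMap at h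
    split_ifs at h <;> omega
  · refine ⟨fun r => if σ r = 1 then b r else 1 - b r, fun r => ?_, funext fun r => ?_⟩
    · have hbr : 0 < b r := hb r
      dsimp only
      split_ifs <;> omega
    · have hbr : 0 < b r := hb r
      simp only [primeMap]
      split_ifs <;> omega

theorem statement_4 (n : ℕ) (hn : 1 ≤ n) (σ : Fin n → ℤ) (hσ : ∀ r, σ r = 1 ∨ σ r = -1) :
    Set.BijOn primeMap (Bsig σ) (B0set n) ∧
    ∀ a ∈ Bsig σ, ∀ b ∈ Bsig σ,
      (BruhatC a b ↔ BruhatA σ (primeMap a) (primeMap b)) := by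
  refine ⟨primeMap_bijOn hσ, fun a ha b hb => ?_⟩
  have hwt {c : Fin n → ℤ} (hc : c ∈ Bsig σ) (s : ℕ) :
      psumA (wtA σ (primeMap c)) s = shiftEmb (psumC (wtC c) s) := by
    rw [shiftEmb_psumC, funext (shiftEmb_wtC hσ hc)]
  have hsum (s : ℕ) : coeffSum (psumC (wtC a) s) = coeffSum (psumC (wtC b) s) := by
    simp only [psumC, map_sum, coeffSum_wtC hσ ha, coeffSum_wtC hσ hb]
  simp only [BruhatC, BruhatA, InvDomC, InvDomA, hwt ha, hwt hb, shiftEmb_injective.eq_iff,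
    domC_iff_domA_shiftEmb (hsum _)]
end

section
/- Let n ≥ 1, B = ℤ^n, and write d_t for the t-th standard basis tuple. Suppose a, b ∈ B satisfy a ⪰ b in the sp_{2∞}-Bruhat order, and for some i ∈ ℕ and some 1 ≤ r ≤ n one has i-sig_r(a) = f and i-sig_n(b) = f (i.e. a_r ∈ {i, −i} and b_n ∈ {i, −i}). Then a + d_r ⪰ b + d_n, and a + d_r = b + d_n if and only if a = b and r = n. -/
/-!
STATEMENT 6: if a ⪰ b in the sp_{2∞}-Bruhat order and the i-signature of a has an
f in position r while that of b has an f in position n, then a + d_r ⪰ b + d_n,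
with equality iff a = b and r = n.
-/

open Finsupp

theorem wtC_add_dvec {n : ℕ} (a : Fin n → ℤ) (i : ℕ) (r : Fin n)
    (ha : a r = (i : ℤ) ∨ a r = -(i : ℤ)) :
    wtC (a + dvec n r) = wtC a - Pi.single r (alphaC i) := by
  funext t
  by_cases ht : t = r
  · subst ht
    simp only [wtC, dvec, Pi.add_apply, Pi.sub_apply, Pi.single_eq_same, if_true, alphaC]
    rcases i with _ | i
    · have h : a t = 0 := by omega
      simp [h, two_smul]
    · rcases ha with h | h
      · have e1 : ((i : ℤ) + 1).toNat = i + 1 := by omega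
        have h1 : (0 : ℤ) < (i : ℤ) + 1 := by omega
        have h2 : (0 : ℤ) < (i : ℤ) + 1 + 1 := by omega
        simp [h, e1, h1, h2]
      · have e1 : ((i : ℤ) + 1).toNat = i + 1 := by omega
        have h1 : ¬ (0 : ℤ) < -((i : ℤ) + 1) := by omega
        have h2 : ¬ (0 : ℤ) < -((i : ℤ) + 1) + 1 := by omega
        have e2 : (-(-((i : ℤ) + 1) + 1)).toNat = i := by omega
        simp only [h, Nat.cast_add, Nat.cast_one, h1, h2, if_false, e2, neg_neg, e1,
          Nat.add_one_ne_zero, Nat.add_sub_cancel]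
        abel
  · simp [wtC, dvec, ht]

theorem psumC_sub_single {n : ℕ} (β : Fin n → PC) (r : Fin n) (x : PC) (s : ℕ) :
    psumC (β - Pi.single r x) s = psumC β s - if (r : ℕ) < s then x else 0 := by
  simp [psumC]

theorem DomC.add_alphaC {lam mu : PC} (h : DomC lam mu) (i : ℕ) :
    DomC lam (mu - alphaC i) := by
  obtain ⟨c, hc⟩ := h
  refine ⟨c + Finsupp.single i 1, ?_⟩
  rw [Finsupp.sum_add_index' (by simp) (by intros; push_cast; rw [add_smul]), ← hc]
  simp
  abel

/-- The homomorphism sending `ε_i` to `-(i + 1)`; it is positive on simple roots. -/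
noncomputable def coheight : PC →+ ℤ :=
  Finsupp.liftAddHom fun i => AddMonoidHom.mulRight (-((i : ℤ) + 1))

theorem coheight_epsC (i : ℕ) : coheight (epsC i) = -((i : ℤ) + 1) := by
  simp [coheight, epsC]

theorem coheight_alphaC_pos (i : ℕ) : 0 < coheight (alphaC i) := by
  rcases i with _ | i <;> simp [alphaC, coheight_epsC]

theorem DomC.coheight_le {lam mu : PC} (h : DomC lam mu) : coheight mu ≤ coheight lam := by
  obtain ⟨c, hc⟩ := h
  rw [← sub_nonneg, ← map_sub, hc, Finsupp.sum, map_sum]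
  refine Finset.sum_nonneg fun i _ => ?_
  rw [map_zsmul, smul_eq_mul]
  exact mul_nonneg (Int.natCast_nonneg _) (coheight_alphaC_pos i).le

theorem statement_6 (n : ℕ) (hn : 1 ≤ n) (a b : Fin n → ℤ) (i : ℕ) (r : Fin n)
    (hab : BruhatC b a)
    (ha : a r = (i : ℤ) ∨ a r = -(i : ℤ))
    (hb : b ⟨n - 1, by omega⟩ = (i : ℤ) ∨ b ⟨n - 1, by omega⟩ = -(i : ℤ)) :
    BruhatC (b + dvec n ⟨n - 1, by omega⟩) (a + dvec n r) ∧
    (a + dvec n r = b + dvec n ⟨n - 1, by omega⟩ ↔ (a = b ∧ r = ⟨n - 1, by omega⟩)) := by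
  have hwa := wtC_add_dvec a i r ha
  have hwb := wtC_add_dvec b i ⟨n - 1, by omega⟩ hb
  obtain ⟨htot, hdom⟩ := hab
  refine ⟨⟨?_, fun s hs1 hsn => ?_⟩, fun h => ?_, ?_⟩
  · rw [hwa, hwb, psumC_sub_single, psumC_sub_single, htot, if_pos r.isLt,
      if_pos (by simp only; omega)]
  · rw [hwa, hwb, psumC_sub_single, psumC_sub_single]
    rcases hsn.eq_or_lt with rfl | hlt
    · rw [htot, if_pos r.isLt, if_pos (by simp only; omega)]
      exact ⟨0, by simp⟩
    · rw [if_neg (by simp only; omega), sub_zero]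
      split_ifs
      · exact (hdom s hs1 hsn).add_alphaC i
      · simpa using hdom s hs1 hsn
  · have hr : r = ⟨n - 1, by omega⟩ := by
      by_contra hne
      have hlt : (r : ℕ) < n - 1 := by
        have := Fin.val_ne_of_ne hne
        simp only at this
        omega
      have hp : psumC (wtC (a + dvec n r)) (n - 1) =
          psumC (wtC (b + dvec n ⟨n - 1, by omega⟩)) (n - 1) := by rw [h]
      rw [hwa, hwb, psumC_sub_single, psumC_sub_single, if_pos hlt, if_neg (by simp),
        sub_zero] at hp
      have hle := (hdom (n - 1) (by omega) (by omega)).coheight_le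
      rw [← hp, map_sub] at hle
      linarith [coheight_alphaC_pos i]
    refine ⟨?_, hr⟩
    rw [← hr] at h
    exact add_right_cancel h
  · rintro ⟨rfl, rfl⟩
    rfl
end

section
/- Let n ≥ 1 and B = ℤ^n. Let B° be the smallest subset of B containing z = (0,0,…,0) and closed under the crystal operators, i.e. if b ∈ B°, i ∈ ℕ, and f̃_i b ≠ ∅ then f̃_i b ∈ B°, and if ẽ_i b ≠ ∅ then ẽ_i b ∈ B°. Then b ∈ B° if and only if b is antidominant, i.e. b_1 ≤ b_2 ≤ ⋯ ≤ b_n. -/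
/-- The i-signature of `b`, recorded as the list of positions carrying a non-• letter
together with the letter (`true` = f, `false` = e), in increasing order of position:
position `t` carries f if `b t = ±i` and e if `b t = 1 ± i`. -/
def sigList (n : ℕ) (i : ℕ) (b : Fin n → ℤ) : List (Fin n × Bool) :=
  (List.finRange n).filterMap fun t =>
    if b t = (i : ℤ) ∨ b t = -(i : ℤ) then some (t, true)
    else if b t = 1 + (i : ℤ) ∨ b t = 1 - (i : ℤ) then some (t, false)
    else none

/-- Reduction of a signature: repeatedly cancel a pair consisting of an e (`false`)
followed (after only •'s, i.e. adjacently in the list of non-• letters) by an f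
(`true`), until no e occurs before any f.  Processing from the right, an e cancels
with the nearest surviving f to its right. -/
def cancel {α : Type} : List (α × Bool) → List (α × Bool)
  | [] => []
  | x :: rest =>
    match cancel rest with
    | (q, true) :: rest' => if x.2 = false then rest' else x :: (q, true) :: rest'
    | l => x :: l

/-- The crystal operator `f̃_i`: add `d_r` where `r` is the position of the rightmost
f in the reduced i-signature, or `∅` (i.e. `none`) if no f remains. -/
def ftilde {n : ℕ} (i : ℕ) (b : Fin n → ℤ) : Option (Fin n → ℤ) :=
  match ((cancel (sigList n i b)).filter fun x => x.2).getLast? with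
  | some x => some (b + dvec n x.1)
  | none => none

/-- The crystal operator `ẽ_i`: subtract `d_s` where `s` is the position of the
leftmost e in the reduced i-signature, or `∅` if no e remains. -/
def etilde {n : ℕ} (i : ℕ) (b : Fin n → ℤ) : Option (Fin n → ℤ) :=
  match ((cancel (sigList n i b)).filter fun x => !x.2).head? with
  | some x => some (b - dvec n x.1)
  | none => none

/-- The smallest subset of ℤ^n containing z = (0,…,0) and closed under the crystal
operators f̃_i and ẽ_i (i ∈ ℕ), i.e. the connected component B° of the crystal. -/
inductive Reachable (n : ℕ) : (Fin n → ℤ) → Prop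
  | base : Reachable n (fun _ => 0)
  | fstep {b c : Fin n → ℤ} (i : ℕ) : Reachable n b → ftilde i b = some c → Reachable n c
  | estep {b c : Fin n → ℤ} (i : ℕ) : Reachable n b → etilde i b = some c → Reachable n c

/-- The letter of the `i`-signature of `b` at position `t`, tagged with `t`. -/
def sigLetter {n : ℕ} (i : ℕ) (b : Fin n → ℤ) (t : Fin n) : Option (Fin n × Bool) :=
  if b t = (i : ℤ) ∨ b t = -(i : ℤ) then some (t, true)
  else if b t = 1 + (i : ℤ) ∨ b t = 1 - (i : ℤ) then some (t, false)
  else none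

theorem sigList_eq {n : ℕ} (i : ℕ) (b : Fin n → ℤ) :
    sigList n i b = (List.finRange n).filterMap (sigLetter i b) := rfl

theorem sigLetter_eq_true {n : ℕ} {i : ℕ} {b : Fin n → ℤ} {t r : Fin n} :
    sigLetter i b t = some (r, true) ↔ t = r ∧ (b t = (i : ℤ) ∨ b t = -(i : ℤ)) := by
  unfold sigLetter
  split_ifs with h1 h2 <;> simp [h1]

theorem sigLetter_eq_false {n : ℕ} {i : ℕ} {b : Fin n → ℤ} {t r : Fin n} :
    sigLetter i b t = some (r, false) ↔ t = r ∧ (b t = 1 + (i : ℤ) ∨ b t = 1 - (i : ℤ)) := by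
  unfold sigLetter
  split_ifs with h1 h2
  · simp only [Option.some.injEq, Prod.mk.injEq, Bool.true_eq_false, and_false, false_iff]
    omega
  · simp [h2]
  · simp [h2]

theorem sigLetter_fst {n : ℕ} {i : ℕ} {b : Fin n → ℤ} {t : Fin n} {x : Fin n × Bool}
    (h : sigLetter i b t = some x) : t = x.1 := by
  obtain ⟨r, _ | _⟩ := x
  · exact (sigLetter_eq_false.1 h).1
  · exact (sigLetter_eq_true.1 h).1

section Cancel

variable {α : Type}

/-- The letters f surviving in the reduction of a signature. -/
def survivingF : List (α × Bool) → List (α × Bool)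
  | [] => []
  | x :: l => if x.2 = true then x :: survivingF l else (survivingF l).tail

/-- The letters e surviving in the reduction of a signature. -/
def survivingE : List (α × Bool) → List (α × Bool)
  | [] => []
  | x :: l => if x.2 = false ∧ survivingF l = [] then x :: survivingE l else survivingE l

theorem snd_of_mem_survivingF {l : List (α × Bool)} {x : α × Bool} (h : x ∈ survivingF l) :
    x.2 = true := by
  induction l with
  | nil => simp [survivingF] at h
  | cons y l ih =>
    by_cases hy : y.2 = true
    · simp only [survivingF, hy, if_true, List.mem_cons] at h
      rcases h with rfl | h
      · exact hy
      · exact ih h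
    · simp only [survivingF, hy] at h
      exact ih (List.mem_of_mem_tail h)

theorem snd_of_mem_survivingE {l : List (α × Bool)} {x : α × Bool} (h : x ∈ survivingE l) :
    x.2 = false := by
  induction l with
  | nil => simp [survivingE] at h
  | cons y l ih =>
    by_cases hy : y.2 = false ∧ survivingF l = []
    · simp only [survivingE, if_pos hy, List.mem_cons] at h
      rcases h with rfl | h
      · exact hy.1
      · exact ih h
    · simp only [survivingE, if_neg hy] at h
      exact ih h

theorem cancel_eq_append (l : List (α × Bool)) : cancel l = survivingF l ++ survivingE l := by
  induction l with
  | nil => rfl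
  | cons x l ih =>
    rw [cancel, ih]
    obtain ⟨p, c⟩ := x
    rcases hF : survivingF l with _ | ⟨⟨q, d⟩, F⟩
    · rcases hE : survivingE l with _ | ⟨⟨q, d⟩, E⟩
      · cases c <;> simp [survivingF, survivingE, hF, hE]
      · have hd : d = false :=
          snd_of_mem_survivingE (l := l) (x := (q, d)) (by simp [hE])
        subst hd
        cases c <;> simp [survivingF, survivingE, hF, hE]
    · have hd : d = true :=
        snd_of_mem_survivingF (l := l) (x := (q, d)) (by simp [hF])
      subst hd
      cases c <;> simp [survivingF, survivingE, hF]

theorem filter_true_cancel (l : List (α × Bool)) :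
    (cancel l).filter (fun x => x.2) = survivingF l := by
  rw [cancel_eq_append, List.filter_append, List.filter_eq_self.2, List.filter_eq_nil_iff.2,
    List.append_nil]
  · intro x hx
    simp [snd_of_mem_survivingE hx]
  · intro x hx
    exact snd_of_mem_survivingF hx

theorem filter_false_cancel (l : List (α × Bool)) :
    (cancel l).filter (fun x => !x.2) = survivingE l := by
  rw [cancel_eq_append, List.filter_append, List.filter_eq_nil_iff.2, List.filter_eq_self.2,
    List.nil_append]
  · intro x hx
    simp [snd_of_mem_survivingE hx]
  · intro x hx
    simp [snd_of_mem_survivingF hx]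

theorem survivingF_append_true {l₁ l₂ : List (α × Bool)} {p : α}
    (h₁ : survivingE l₁ = []) (h₂ : survivingF l₂ = []) :
    survivingF (l₁ ++ (p, true) :: l₂) = survivingF l₁ ++ [(p, true)] := by
  induction l₁ with
  | nil => simp [survivingF, h₂]
  | cons y l ih =>
    obtain ⟨q, _ | _⟩ := y
    · by_cases hF : survivingF l = []
      · simp [survivingE, hF] at h₁
      · simp only [survivingE, hF, and_false, if_false] at h₁
        simp [survivingF, ih h₁, List.tail_append_of_ne_nil hF]
    · simp only [survivingE, Bool.true_eq_false, false_and, if_false] at h₁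
      simp [survivingF, ih h₁]

theorem surviving_append_false {l₁ l₂ : List (α × Bool)} {p : α}
    (h₁ : survivingE l₁ = []) (h₂ : survivingF l₂ = []) :
    survivingF (l₁ ++ (p, false) :: l₂) = survivingF l₁ ∧
      survivingE (l₁ ++ (p, false) :: l₂) = (p, false) :: survivingE l₂ := by
  induction l₁ with
  | nil => simp [survivingF, survivingE, h₂]
  | cons y l ih =>
    obtain ⟨q, _ | _⟩ := y
    · by_cases hF : survivingF l = []
      · simp [survivingE, hF] at h₁
      · simp only [survivingE, hF, and_false, if_false] at h₁
        simp [survivingF, survivingE, ih h₁, hF]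
    · simp only [survivingE, Bool.true_eq_false, false_and, if_false] at h₁
      simp [survivingF, survivingE, ih h₁]

theorem surviving_concat_false (l : List (α × Bool)) (p : α) :
    survivingF (l ++ [(p, false)]) = survivingF l ∧
      survivingE (l ++ [(p, false)]) = survivingE l ++ [(p, false)] := by
  induction l with
  | nil => simp [survivingF, survivingE]
  | cons y l ih =>
    constructor
    · simp [survivingF, ih.1]
    · by_cases h : y.2 = false ∧ survivingF l = [] <;> simp [survivingE, ih, h]

theorem getLast?_survivingF_eq_some {l : List (α × Bool)} {x : α × Bool} :
    (survivingF l).getLast? = some x ↔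
      ∃ p l₁ l₂, x = (p, true) ∧ l = l₁ ++ (p, true) :: l₂ ∧
        survivingE l₁ = [] ∧ survivingF l₂ = [] := by
  constructor
  · intro h
    induction l with
    | nil => simp [survivingF] at h
    | cons y l ih =>
      obtain ⟨q, _ | _⟩ := y
      · simp only [survivingF, Bool.false_eq_true, if_false, List.getLast?_tail] at h
        split_ifs at h with hlen
        obtain ⟨p, l₁, l₂, rfl, rfl, h₁, h₂⟩ := ih h
        refine ⟨p, (q, false) :: l₁, l₂, rfl, rfl, ?_, h₂⟩
        rw [survivingF_append_true h₁ h₂] at hlen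
        have hF : survivingF l₁ ≠ [] := by
          intro h0
          simp [h0] at hlen
        simp [survivingE, hF, h₁]
      · by_cases hF : survivingF l = []
        · simp only [survivingF, if_true, hF, List.getLast?_singleton, Option.some.injEq] at h
          exact ⟨q, [], l, h.symm, rfl, rfl, hF⟩
        · simp only [survivingF, if_true] at h
          rw [List.getLast?_cons_of_ne_nil hF] at h
          obtain ⟨p, l₁, l₂, rfl, rfl, h₁, h₂⟩ := ih h
          exact ⟨p, (q, true) :: l₁, l₂, rfl, rfl, by simp [survivingE, h₁], h₂⟩
  · rintro ⟨p, l₁, l₂, rfl, rfl, h₁, h₂⟩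
    simp [survivingF_append_true h₁ h₂]

theorem head?_survivingE_eq_some {l : List (α × Bool)} {x : α × Bool} :
    (survivingE l).head? = some x ↔
      ∃ p l₁ l₂, x = (p, false) ∧ l = l₁ ++ (p, false) :: l₂ ∧
        survivingE l₁ = [] ∧ survivingF l₂ = [] := by
  constructor
  · intro h
    induction l with
    | nil => simp [survivingE] at h
    | cons y l ih =>
      by_cases hy : y.2 = false ∧ survivingF l = []
      · simp only [survivingE, if_pos hy, List.head?_cons, Option.some.injEq] at h
        subst h
        obtain ⟨q, c⟩ := y
        obtain ⟨rfl, hF⟩ := hy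
        exact ⟨q, [], l, rfl, rfl, rfl, hF⟩
      · simp only [survivingE, if_neg hy] at h
        obtain ⟨p, l₁, l₂, rfl, rfl, h₁, h₂⟩ := ih h
        rw [(surviving_append_false h₁ h₂).1] at hy
        exact ⟨p, y :: l₁, l₂, rfl, rfl, by simp only [survivingE, if_neg hy, h₁], h₂⟩
  · rintro ⟨p, l₁, l₂, rfl, rfl, h₁, h₂⟩
    simp [(surviving_append_false h₁ h₂).2]

end Cancel

section Crystal

variable {n : ℕ} {i : ℕ} {b c : Fin n → ℤ}

theorem ftilde_eq_some_iff :
    ftilde i b = some c ↔ ∃ r l₁ l₂, sigList n i b = l₁ ++ (r, true) :: l₂ ∧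
      survivingE l₁ = [] ∧ survivingF l₂ = [] ∧ c = b + dvec n r := by
  rw [ftilde, filter_true_cancel]
  constructor
  · intro h
    rcases hx : (survivingF (sigList n i b)).getLast? with _ | x
    · simp [hx] at h
    · obtain ⟨p, l₁, l₂, rfl, hl, h₁, h₂⟩ := getLast?_survivingF_eq_some.1 hx
      simp only [hx, Option.some.injEq] at h
      exact ⟨p, l₁, l₂, hl, h₁, h₂, h.symm⟩
  · rintro ⟨p, l₁, l₂, hl, h₁, h₂, rfl⟩
    rw [getLast?_survivingF_eq_some.2 ⟨p, l₁, l₂, rfl, hl, h₁, h₂⟩]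

theorem etilde_eq_some_iff :
    etilde i b = some c ↔ ∃ r l₁ l₂, sigList n i b = l₁ ++ (r, false) :: l₂ ∧
      survivingE l₁ = [] ∧ survivingF l₂ = [] ∧ c = b - dvec n r := by
  rw [etilde, filter_false_cancel]
  constructor
  · intro h
    rcases hx : (survivingE (sigList n i b)).head? with _ | x
    · simp [hx] at h
    · obtain ⟨p, l₁, l₂, rfl, hl, h₁, h₂⟩ := head?_survivingE_eq_some.1 hx
      simp only [hx, Option.some.injEq] at h
      exact ⟨p, l₁, l₂, hl, h₁, h₂, h.symm⟩
  · rintro ⟨p, l₁, l₂, hl, h₁, h₂, rfl⟩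
    rw [head?_survivingE_eq_some.2 ⟨p, l₁, l₂, rfl, hl, h₁, h₂⟩]

theorem exists_ftilde_eq_some (h : survivingF (sigList n i b) ≠ []) : ∃ c, ftilde i b = some c := by
  rw [ftilde, filter_true_cancel, List.getLast?_eq_some_getLast h]
  exact ⟨_, rfl⟩

theorem exists_etilde_eq_some (h : survivingE (sigList n i b) ≠ []) : ∃ c, etilde i b = some c := by
  rw [etilde, filter_false_cancel, List.head?_eq_some_head h]
  exact ⟨_, rfl⟩

theorem sigList_split {r : Fin n} {x : Bool} {l₁ l₂ : List (Fin n × Bool)}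
    (h : sigList n i b = l₁ ++ (r, x) :: l₂) :
    ∃ s t, List.finRange n = s ++ r :: t ∧ s.filterMap (sigLetter i b) = l₁ ∧
      t.filterMap (sigLetter i b) = l₂ ∧ sigLetter i b r = some (r, x) := by
  rw [sigList_eq, List.filterMap_eq_append_iff] at h
  obtain ⟨s, u, hs, rfl, hu⟩ := h
  obtain ⟨v, a, t, rfl, hv, ha, rfl⟩ := List.filterMap_eq_cons_iff.1 hu
  obtain rfl : a = r := sigLetter_fst ha
  refine ⟨s ++ v, t, by simp [hs], ?_, rfl, ha⟩
  rw [List.filterMap_append, List.filterMap_eq_nil_iff.2 hv, List.append_nil]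

theorem lt_of_finRange_split {r : Fin n} {s t : List (Fin n)}
    (h : List.finRange n = s ++ r :: t) : (∀ a ∈ s, a < r) ∧ ∀ a ∈ t, r < a := by
  have hp := List.pairwise_lt_finRange n
  rw [h, List.pairwise_append, List.pairwise_cons] at hp
  exact ⟨fun a ha => hp.2.2 a ha r (by simp), hp.2.1.1⟩

theorem sigList_of_eq_off {r : Fin n} {x y : Bool} {l₁ l₂ : List (Fin n × Bool)}
    (h : sigList n i b = l₁ ++ (r, x) :: l₂) (hc : ∀ a, a ≠ r → c a = b a)
    (hr : sigLetter i c r = some (r, y)) : sigList n i c = l₁ ++ (r, y) :: l₂ := by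
  obtain ⟨s, t, hst, rfl, rfl, -⟩ := sigList_split h
  obtain ⟨hs, ht⟩ := lt_of_finRange_split hst
  have key : ∀ a, a ≠ r → sigLetter i c a = sigLetter i b a := fun a ha => by
    simp only [sigLetter, hc a ha]
  rw [sigList_eq, hst, List.filterMap_append, List.filterMap_cons_some hr,
    List.filterMap_congr fun a ha => key a (hs a ha).ne,
    List.filterMap_congr fun a ha => key a (ht a ha).ne']

theorem etilde_of_ftilde (h : ftilde i b = some c) : etilde i c = some b := by
  obtain ⟨r, l₁, l₂, hl, h₁, h₂, rfl⟩ := ftilde_eq_some_iff.1 h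
  obtain ⟨-, -, -, -, -, hr⟩ := sigList_split hl
  refine etilde_eq_some_iff.2 ⟨r, l₁, l₂, ?_, h₁, h₂, by simp⟩
  refine sigList_of_eq_off hl (fun a ha => by simp [dvec, ha]) ?_
  rw [sigLetter_eq_true] at hr
  rw [sigLetter_eq_false]
  simp only [Pi.add_apply, dvec, if_true, true_and]
  omega

theorem ftilde_of_etilde (h : etilde i b = some c) : ftilde i c = some b := by
  obtain ⟨r, l₁, l₂, hl, h₁, h₂, rfl⟩ := etilde_eq_some_iff.1 h
  obtain ⟨-, -, -, -, -, hr⟩ := sigList_split hl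
  refine ftilde_eq_some_iff.2 ⟨r, l₁, l₂, ?_, h₁, h₂, by simp⟩
  refine sigList_of_eq_off hl (fun a ha => by simp [dvec, ha]) ?_
  rw [sigLetter_eq_false] at hr
  rw [sigLetter_eq_true]
  simp only [Pi.sub_apply, dvec, if_true, true_and]
  omega

theorem eq_add_dvec_of_ftilde (h : ftilde i b = some c) :
    ∃ r, (b r = i ∨ b r = -(i : ℤ)) ∧ c = b + dvec n r := by
  obtain ⟨r, l₁, l₂, hl, -, -, rfl⟩ := ftilde_eq_some_iff.1 h
  obtain ⟨-, -, -, -, -, hr⟩ := sigList_split hl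
  exact ⟨r, (sigLetter_eq_true.1 hr).2, rfl⟩

theorem eq_sub_dvec_of_etilde (h : etilde i b = some c) :
    ∃ r, (b r = 1 + (i : ℤ) ∨ b r = 1 - (i : ℤ)) ∧ c = b - dvec n r := by
  obtain ⟨r, l₁, l₂, hl, -, -, rfl⟩ := etilde_eq_some_iff.1 h
  obtain ⟨-, -, -, -, -, hr⟩ := sigList_split hl
  exact ⟨r, (sigLetter_eq_false.1 hr).2, rfl⟩

theorem Monotone.ftilde (hb : Monotone b) (h : ftilde i b = some c) : Monotone c := by
  obtain ⟨r, l₁, l₂, hl, -, h₂, rfl⟩ := ftilde_eq_some_iff.1 h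
  obtain ⟨s, t, hst, -, rfl, hr⟩ := sigList_split hl
  rw [sigLetter_eq_true] at hr
  have ht := (lt_of_finRange_split hst).2
  have key : ∀ a, r < a → b r < b a := by
    intro a hra
    refine lt_of_le_of_ne (hb hra.le) fun heq => ?_
    have hat : a ∈ t := by
      have ha := List.mem_finRange a
      rw [hst, List.mem_append, List.mem_cons] at ha
      rcases ha with ha | ha | ha
      · exact absurd ((lt_of_finRange_split hst).1 a ha) hra.not_gt
      · exact absurd ha hra.ne'
      · exact ha
    rcases t with _ | ⟨d, t⟩
    · simp at hat
    have hp := List.pairwise_lt_finRange n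
    rw [hst, List.pairwise_append, List.pairwise_cons, List.pairwise_cons] at hp
    have hda : d ≤ a := by
      rcases List.mem_cons.1 hat with rfl | hat
      · exact le_rfl
      · exact (hp.2.1.2.1 a hat).le
    have hbd : b d = b r := le_antisymm (heq ▸ hb hda) (hb (ht d (by simp)).le)
    rw [List.filterMap_cons_some (sigLetter_eq_true.2 ⟨rfl, hbd ▸ hr.2⟩)] at h₂
    simp [survivingF] at h₂
  intro x y hxy
  have h1 := hb hxy
  simp only [Pi.add_apply, dvec]
  split_ifs with hx hy hy
  · omega
  · subst hx
    have := key y (lt_of_le_of_ne hxy (Ne.symm hy))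
    omega
  · omega
  · omega

theorem Monotone.etilde (hb : Monotone b) (h : etilde i b = some c) : Monotone c := by
  obtain ⟨r, l₁, l₂, hl, h₁, -, rfl⟩ := etilde_eq_some_iff.1 h
  obtain ⟨s, t, hst, rfl, -, hr⟩ := sigList_split hl
  rw [sigLetter_eq_false] at hr
  have hs := (lt_of_finRange_split hst).1
  have key : ∀ a, a < r → b a < b r := by
    intro a har
    refine lt_of_le_of_ne (hb har.le) fun heq => ?_
    have has : a ∈ s := by
      have ha := List.mem_finRange a
      rw [hst, List.mem_append, List.mem_cons] at ha
      rcases ha with ha | ha | ha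
      · exact ha
      · exact absurd ha har.ne
      · exact absurd ((lt_of_finRange_split hst).2 a ha) har.not_gt
    rcases List.eq_nil_or_concat' s with rfl | ⟨s, d, rfl⟩
    · simp at has
    have hp := List.pairwise_lt_finRange n
    rw [hst, List.pairwise_append, List.pairwise_append] at hp
    have had : a ≤ d := by
      rcases List.mem_append.1 has with has | has
      · exact (hp.1.2.2 a has d (by simp)).le
      · exact (List.mem_singleton.1 has).le
    have hbd : b d = b r := le_antisymm (hb (hs d (by simp)).le) (heq ▸ hb had)
    rw [List.filterMap_append,
      List.filterMap_cons_some (sigLetter_eq_false.2 ⟨rfl, hbd ▸ hr.2⟩), List.filterMap_nil,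
      (surviving_concat_false _ _).2] at h₁
    simp at h₁
  intro x y hxy
  have h1 := hb hxy
  simp only [Pi.sub_apply, dvec]
  split_ifs with hx hy hy
  · omega
  · omega
  · subst hy
    have := key x (lt_of_le_of_ne hxy hx)
    omega
  · omega

theorem exists_ftilde_of_min (hb : Monotone b) {t : Fin n} (ht : b t = -(i : ℤ))
    (hmin : ∀ a, -(i : ℤ) ≤ b a) : ∃ c, ftilde i b = some c := by
  apply exists_ftilde_eq_some
  have hmem := List.mem_finRange t
  have hp := List.pairwise_lt_finRange n
  rw [sigList_eq]
  rcases hl : List.finRange n with _ | ⟨d, l⟩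
  · simp [hl] at hmem
  rw [hl] at hmem hp
  have hdt : d ≤ t := by
    rcases List.mem_cons.1 hmem with rfl | hm
    · exact le_rfl
    · exact ((List.pairwise_cons.1 hp).1 t hm).le
  have hbd : b d = -(i : ℤ) := le_antisymm (ht ▸ hb hdt) (hmin d)
  rw [List.filterMap_cons_some (sigLetter_eq_true.2 ⟨rfl, Or.inr hbd⟩)]
  simp [survivingF]

theorem exists_etilde_of_max (hb : Monotone b) {t : Fin n} (ht : b t = 1 + (i : ℤ))
    (hmax : ∀ a, b a ≤ 1 + (i : ℤ)) : ∃ c, etilde i b = some c := by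
  apply exists_etilde_eq_some
  have hmem := List.mem_finRange t
  have hp := List.pairwise_lt_finRange n
  rw [sigList_eq]
  rcases List.eq_nil_or_concat' (List.finRange n) with hl | ⟨l, d, hl⟩
  · simp [hl] at hmem
  rw [hl] at hmem hp ⊢
  have htd : t ≤ d := by
    rcases List.mem_append.1 hmem with hm | hm
    · exact ((List.pairwise_append.1 hp).2.2 t hm d (by simp)).le
    · exact (List.mem_singleton.1 hm).le
  have hbd : b d = 1 + (i : ℤ) := le_antisymm (hmax d) (ht ▸ hb htd)
  rw [List.filterMap_append,
    List.filterMap_cons_some (sigLetter_eq_false.2 ⟨rfl, Or.inl hbd⟩), List.filterMap_nil,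
    (surviving_concat_false _ _).2]
  simp

theorem sum_dvec (r : Fin n) : ∑ t, dvec n r t = 1 := by
  simp [dvec]

theorem Reachable.monotone (h : Reachable n b) : Monotone b := by
  induction h with
  | base => exact monotone_const
  | fstep i _ h ih => exact ih.ftilde h
  | estep i _ h ih => exact ih.etilde h

/-- Raise the entries `-(M + 1)` using `f̃_{M+1}`. -/
theorem reachable_of_lt (M : ℕ)
    (hM : ∀ b : Fin n → ℤ, Monotone b → (∀ t, -(M : ℤ) ≤ b t ∧ b t ≤ M) → Reachable n b)
    (hb : Monotone b) (hbd : ∀ t, -((M : ℤ) + 1) ≤ b t ∧ b t ≤ M) : Reachable n b := by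
  obtain ⟨k, hk⟩ : ∃ k : ℕ, ∑ t, ((M : ℤ) - b t) < k :=
    ⟨(∑ t, ((M : ℤ) - b t)).toNat + 1, by push_cast; omega⟩
  induction k generalizing b with
  | zero =>
    have : 0 ≤ ∑ t, ((M : ℤ) - b t) := Finset.sum_nonneg fun t _ => by linarith [(hbd t).2]
    push_cast at hk
    omega
  | succ k ih =>
    by_cases hex : ∃ t, b t = -((M : ℤ) + 1)
    · obtain ⟨t, ht⟩ := hex
      obtain ⟨c, hc⟩ := exists_ftilde_of_min (i := M + 1) hb (t := t) (by push_cast; exact ht)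
        (fun a => by push_cast; exact (hbd a).1)
      obtain ⟨r, hr, hcr⟩ := eq_add_dvec_of_ftilde hc
      refine .estep (M + 1) (ih (hb.ftilde hc) (fun a => ?_) ?_) (etilde_of_ftilde hc)
      · have h1 := hbd a
        have h2 := hbd r
        simp only [hcr, Pi.add_apply, dvec]
        push_cast at hr
        split_ifs with har
        · subst har
          omega
        · omega
      · have := sum_dvec r
        simp only [hcr, Pi.add_apply, Finset.sum_sub_distrib, Finset.sum_add_distrib] at hk ⊢
        push_cast at hk
        omega
    · push Not at hex
      exact hM b hb fun t => ⟨by have := hbd t; have := hex t; omega, (hbd t).2⟩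

/-- Lower the entries `M + 1` using `ẽ_M`. -/
theorem reachable_of_le (M : ℕ)
    (hM : ∀ b : Fin n → ℤ, Monotone b → (∀ t, -((M : ℤ) + 1) ≤ b t ∧ b t ≤ M) → Reachable n b)
    (hb : Monotone b) (hbd : ∀ t, -((M : ℤ) + 1) ≤ b t ∧ b t ≤ M + 1) : Reachable n b := by
  obtain ⟨k, hk⟩ : ∃ k : ℕ, ∑ t, (b t + ((M : ℤ) + 1)) < k :=
    ⟨(∑ t, (b t + ((M : ℤ) + 1))).toNat + 1, by push_cast; omega⟩
  induction k generalizing b with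
  | zero =>
    have : 0 ≤ ∑ t, (b t + ((M : ℤ) + 1)) :=
      Finset.sum_nonneg fun t _ => by linarith [(hbd t).1]
    push_cast at hk
    omega
  | succ k ih =>
    by_cases hex : ∃ t, b t = 1 + (M : ℤ)
    · obtain ⟨t, ht⟩ := hex
      obtain ⟨c, hc⟩ := exists_etilde_of_max hb ht fun a => by linarith [(hbd a).2]
      obtain ⟨r, hr, hcr⟩ := eq_sub_dvec_of_etilde hc
      refine .fstep M (ih (hb.etilde hc) (fun a => ?_) ?_) (ftilde_of_etilde hc)
      · have h1 := hbd a
        simp only [hcr, Pi.sub_apply, dvec]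
        split_ifs with har
        · subst har
          omega
        · omega
      · have := sum_dvec r
        simp only [hcr, Pi.sub_apply, Finset.sum_sub_distrib, Finset.sum_add_distrib] at hk ⊢
        push_cast at hk
        omega
    · push Not at hex
      exact hM b hb fun t => ⟨(hbd t).1, by have := hbd t; have := hex t; omega⟩

theorem Monotone.reachable_of_bounded (M : ℕ) (hb : Monotone b)
    (hbd : ∀ t, -(M : ℤ) ≤ b t ∧ b t ≤ M) : Reachable n b := by
  induction M generalizing b with
  | zero =>
    obtain rfl : b = fun _ => 0 := funext fun t => by
      have := hbd t
      push_cast at this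
      omega
    exact .base
  | succ M ih =>
    push_cast at hbd
    exact reachable_of_le M (fun _ hc hcd => reachable_of_lt M (fun _ => ih) hc hcd) hb hbd

theorem Monotone.reachable (hb : Monotone b) : Reachable n b := by
  refine hb.reachable_of_bounded (∑ t, (b t).natAbs) fun t => ?_
  have := Finset.single_le_sum (f := fun t => (b t).natAbs) (fun _ _ => Nat.zero_le _)
    (Finset.mem_univ t)
  omega

end Crystal

theorem statement_8 (n : ℕ) (hn : 1 ≤ n) (b : Fin n → ℤ) :
    Reachable n b ↔ ∀ r s : Fin n, r ≤ s → b r ≤ b s := by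
  exact ⟨fun h r s hrs => h.monotone hrs, fun h => Monotone.reachable fun r s => h r s⟩
end

section
/- Let n ≥ 1 and let a ∈ ℤ^n be antidominant, i.e. a_1 ≤ a_2 ≤ ⋯ ≤ a_n. Then for every i ∈ ℕ: if f̃_i a ≠ ∅ then f̃_i a is antidominant, and if ẽ_i a ≠ ∅ then ẽ_i a is antidominant. -/
theorem cancel_cons_true {α : Type} (p : α) (l : List (α × Bool)) :
    cancel ((p, true) :: l) = (p, true) :: cancel l := by
  rw [cancel]
  split <;> simp_all

theorem cancel_cons_false {α : Type} (p : α) (l : List (α × Bool)) :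
    (∃ q t, cancel l = (q, true) :: t ∧ cancel ((p, false) :: l) = t) ∨
      cancel ((p, false) :: l) = (p, false) :: cancel l := by
  rw [cancel]
  split
  · rename_i q t h
    exact Or.inl ⟨q, t, h, by simp⟩
  · exact Or.inr rfl

theorem cancel_sublist {α : Type} (l : List (α × Bool)) : (cancel l).Sublist l := by
  induction l with
  | nil => simp [cancel]
  | cons x l ih =>
    obtain ⟨p, _ | _⟩ := x
    · rcases cancel_cons_false p l with ⟨q, t, h, h'⟩ | h
      · rw [h']
        rw [h] at ih
        exact ((List.sublist_cons_self _ _).trans ih).cons _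
      · rw [h]
        exact ih.cons_cons _
    · rw [cancel_cons_true]
      exact ih.cons_cons _

section Block

variable {α β : Type} [LinearOrder α] [PartialOrder β]

/-- An f preceded only by f's is never cancelled. -/
theorem mem_cancel_of_forall_le {l : List (α × Bool)} {s : α} (hs : (s, true) ∈ l)
    (hsort : l.Pairwise fun x y => x.1 < y.1)
    (hl : ∀ x ∈ l, x.1 ≤ s → x.2 = true) : (s, true) ∈ cancel l := by
  induction l with
  | nil => simp at hs
  | cons x l ih =>
    obtain ⟨p, b⟩ := x
    rw [List.pairwise_cons] at hsort
    rcases List.mem_cons.1 hs with h | h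
    · rw [← h, cancel_cons_true]
      exact List.mem_cons_self
    · obtain rfl : b = true := hl (p, b) List.mem_cons_self (hsort.1 _ h).le
      rw [cancel_cons_true]
      exact List.mem_cons_of_mem _
        (ih h hsort.2 fun y hy => hl y (List.mem_cons_of_mem _ hy))

/-- In a block of equal entries, every f to the right of an uncancelled f is uncancelled. -/
theorem mem_cancel_true_of_lt {a : α → β} (ha : Monotone a) {l : List (α × Bool)}
    (hsort : l.Pairwise fun x y => x.1 < y.1)
    (hl : ∀ x ∈ l, ∀ y ∈ l, a x.1 = a y.1 → x.2 = y.2) {r s : α}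
    (hr : (r, true) ∈ cancel l) (hs : (s, true) ∈ l) (hrs : r < s) (heq : a r = a s) :
    (s, true) ∈ cancel l := by
  induction l with
  | nil => simp at hs
  | cons x l ih =>
    have hsort' := List.pairwise_cons.1 hsort
    have hl' : ∀ x ∈ l, ∀ y ∈ l, a x.1 = a y.1 → x.2 = y.2 := fun x hx y hy =>
      hl x (List.mem_cons_of_mem _ hx) y (List.mem_cons_of_mem _ hy)
    have hsl : (s, true) ∈ l := by
      rcases List.mem_cons.1 hs with h | h
      · rcases List.mem_cons.1 ((cancel_sublist _).subset hr) with h' | h'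
        · grind
        · have := hsort'.1 _ h'
          grind
      · exact h
    obtain ⟨p, _ | _⟩ := x
    · rcases cancel_cons_false p l with ⟨q, t, h, h'⟩ | h
      · rw [h'] at hr ⊢
        have hmem := ih hsort'.2 hl' (by simp [h, hr]) hsl
        rw [h] at hmem
        have hc := hsort'.2.sublist (cancel_sublist l)
        rw [h, List.pairwise_cons] at hc
        have := hc.1 _ hr
        grind
      · rw [h] at hr ⊢
        exact List.mem_cons_of_mem _ (ih hsort'.2 hl' (by simpa using hr) hsl)
    · rw [cancel_cons_true] at hr ⊢
      refine List.mem_cons_of_mem _ ?_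
      rcases List.mem_cons.1 hr with h | h
      · obtain rfl : r = p := congrArg Prod.fst h
        refine mem_cancel_of_forall_le hsl hsort'.2 fun y hy hys => ?_
        exact hl y (List.mem_cons_of_mem _ hy) (s, true) hs
          (le_antisymm (ha hys) (heq ▸ ha (hsort'.1 _ hy).le))
      · exact ih hsort'.2 hl' h hsl

/-- In a block of equal entries, every e to the left of an uncancelled e is uncancelled. -/
theorem mem_cancel_false_of_lt {a : α → β} (ha : Monotone a) {l : List (α × Bool)}
    (hsort : l.Pairwise fun x y => x.1 < y.1)
    (hl : ∀ x ∈ l, ∀ y ∈ l, a x.1 = a y.1 → x.2 = y.2) {r s : α}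
    (hs : (s, false) ∈ cancel l) (hr : (r, false) ∈ l) (hrs : r < s) (heq : a r = a s) :
    (r, false) ∈ cancel l := by
  induction l with
  | nil => simp at hr
  | cons x l ih =>
    have hsort' := List.pairwise_cons.1 hsort
    have hl' : ∀ x ∈ l, ∀ y ∈ l, a x.1 = a y.1 → x.2 = y.2 := fun x hx y hy =>
      hl x (List.mem_cons_of_mem _ hx) y (List.mem_cons_of_mem _ hy)
    have hsl : (s, false) ∈ (x :: l) := (cancel_sublist _).subset hs
    obtain ⟨p, _ | _⟩ := x
    · rcases cancel_cons_false p l with ⟨q, t, h, h'⟩ | h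
      · rw [h'] at hs ⊢
        have hc := hsort'.2.sublist (cancel_sublist l)
        rw [h, List.pairwise_cons] at hc
        have hq : (q, true) ∈ l := (cancel_sublist l).subset (by simp [h])
        rcases List.mem_cons.1 hr with hp | hp
        · obtain rfl : r = p := congrArg Prod.fst hp
          have := hl (q, true) (List.mem_cons_of_mem _ hq) (s, false) hsl
            (le_antisymm (ha (hc.1 _ hs).le) (heq ▸ ha (hsort'.1 _ hq).le))
          simp at this
        · have hmem := ih hsort'.2 hl' (by simp [h, hs]) hp
          simpa [h] using hmem
      · rw [h] at hs ⊢
        rcases List.mem_cons.1 hr with hp | hp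
        · exact hp ▸ List.mem_cons_self
        · rcases List.mem_cons.1 hs with hp' | hp'
          · have := hsort'.1 _ hp
            grind
          · exact List.mem_cons_of_mem _ (ih hsort'.2 hl' hp' hp)
    · rw [cancel_cons_true] at hs ⊢
      exact List.mem_cons_of_mem _
        (ih hsort'.2 hl' (by simpa using hs) (by simpa using hr))

end Block

theorem mem_sigList {n i : ℕ} {b : Fin n → ℤ} {x : Fin n × Bool} :
    x ∈ sigList n i b ↔ (if b x.1 = (i : ℤ) ∨ b x.1 = -(i : ℤ) then some true
      else if b x.1 = 1 + (i : ℤ) ∨ b x.1 = 1 - (i : ℤ) then some false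
      else none) = some x.2 := by
  obtain ⟨t, c⟩ := x
  simp only [sigList, List.mem_filterMap, List.mem_finRange, true_and]
  constructor
  · rintro ⟨u, hu⟩
    grind
  · intro h
    exact ⟨t, by grind⟩

theorem sigList_pairwise (n i : ℕ) (b : Fin n → ℤ) :
    (sigList n i b).Pairwise fun x y => x.1 < y.1 := by
  rw [sigList, List.pairwise_filterMap]
  refine (List.pairwise_lt_finRange n).imp fun {u v} huv x hx y hy => ?_
  grind

theorem sigList_letter_eq {n i : ℕ} {b : Fin n → ℤ} :
    ∀ x ∈ sigList n i b, ∀ y ∈ sigList n i b, b x.1 = b y.1 → x.2 = y.2 := by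
  intro x hx y hy h
  rw [mem_sigList] at hx hy
  rw [h, hy] at hx
  exact (Option.some_inj.1 hx).symm

theorem mem_sigList_of_eq {n i : ℕ} {b : Fin n → ℤ} {r s : Fin n} {c : Bool}
    (hr : (r, c) ∈ sigList n i b) (h : b r = b s) : (s, c) ∈ sigList n i b := by
  rw [mem_sigList] at hr ⊢
  simpa only [← h] using hr

theorem ftilde_eq_some {n i : ℕ} {a c : Fin n → ℤ} (ha : Monotone a)
    (h : ftilde i a = some c) :
    ∃ r, c = a + dvec n r ∧ ∀ s, r < s → a r < a s := by
  unfold ftilde at h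
  split at h
  · rename_i x hx
    refine ⟨x.1, (Option.some_inj.1 h).symm, fun s hs => (ha hs.le).lt_of_ne fun heq => ?_⟩
    obtain ⟨l, hlast⟩ := List.getLast?_eq_some_iff.1 hx
    have hmem : x ∈ (cancel (sigList n i a)).filter fun x => x.2 := by simp [hlast]
    obtain ⟨hxc, hxt⟩ := List.mem_filter.1 hmem
    obtain ⟨r, b⟩ := x
    obtain rfl : b = true := hxt
    have hsc := mem_cancel_true_of_lt ha (sigList_pairwise n i a) sigList_letter_eq hxc
      (mem_sigList_of_eq ((cancel_sublist _).subset hxc) heq) hs heq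
    have hsf : (s, true) ∈ (cancel (sigList n i a)).filter fun x => x.2 :=
      List.mem_filter.2 ⟨hsc, rfl⟩
    have hp := ((sigList_pairwise n i a).sublist (cancel_sublist _)).filter fun x => x.2
    rw [hlast, List.pairwise_append] at hp
    rw [hlast] at hsf
    have := hp.2.2 (s, true)
    grind
  · simp at h

theorem etilde_eq_some {n i : ℕ} {a c : Fin n → ℤ} (ha : Monotone a)
    (h : etilde i a = some c) :
    ∃ s, c = a - dvec n s ∧ ∀ r, r < s → a r < a s := by
  unfold etilde at h
  split at h
  · rename_i x hx
    refine ⟨x.1, (Option.some_inj.1 h).symm, fun r hr => (ha hr.le).lt_of_ne fun heq => ?_⟩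
    obtain ⟨l, hhead⟩ := List.head?_eq_some_iff.1 hx
    have hmem : x ∈ (cancel (sigList n i a)).filter fun x => !x.2 := by simp [hhead]
    obtain ⟨hxc, hxt⟩ := List.mem_filter.1 hmem
    obtain ⟨s, b⟩ := x
    obtain rfl : b = false := by simpa using hxt
    have hrc := mem_cancel_false_of_lt ha (sigList_pairwise n i a) sigList_letter_eq hxc
      (mem_sigList_of_eq ((cancel_sublist _).subset hxc) heq.symm) hr heq
    have hrf : (r, false) ∈ (cancel (sigList n i a)).filter fun x => !x.2 :=
      List.mem_filter.2 ⟨hrc, rfl⟩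
    have hp := ((sigList_pairwise n i a).sublist (cancel_sublist _)).filter fun x => !x.2
    rw [hhead, List.pairwise_cons] at hp
    rw [hhead] at hrf
    have := hp.1 (r, false)
    grind
  · simp at h

theorem statement_9 (n : ℕ) (hn : 1 ≤ n) (a : Fin n → ℤ)
    (ha : ∀ r s : Fin n, r ≤ s → a r ≤ a s) (i : ℕ) :
    (∀ c : Fin n → ℤ, ftilde i a = some c → ∀ r s : Fin n, r ≤ s → c r ≤ c s) ∧
    (∀ c : Fin n → ℤ, etilde i a = some c → ∀ r s : Fin n, r ≤ s → c r ≤ c s) := by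
  refine ⟨fun c hc r s hrs => ?_, fun c hc r s hrs => ?_⟩
  · obtain ⟨t, rfl, ht⟩ := ftilde_eq_some (fun r s => ha r s) hc
    have h₁ := ha r s hrs
    have h₂ := ht s
    simp only [Pi.add_apply, dvec]
    grind
  · obtain ⟨t, rfl, ht⟩ := etilde_eq_some (fun r s => ha r s) hc
    have h₁ := ha r s hrs
    have h₂ := ht r
    simp only [Pi.sub_apply, dvec]
    grind
end

section
/- Let n ≥ 1, B = ℤ^n, and fix an integer k ≥ 1. Define B_{≤k} := {b ∈ B : N_{[1,s]}(b,k) ≤ 0 for s = 1,…,n−1, and N_{[1,n]}(b,k) = 0}, and B_{<k} := {b ∈ B_{≤k} : N_{[1,s]}(b,k) < 0 for at least one s ∈ {1,…,n−1}}. Then: (i) B_{≤k} and B_{<k} are both lower sets (ideals) in B with respect to the sp_{2∞}-Bruhat order ⪯, i.e. if b belongs to the set and a ⪯ b then a belongs to the set; and (ii) B_{≤k} \ B_{<k} = B_k := {b ∈ B : −k < b_r ≤ k for all r}. -/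
/-!
STATEMENT 11: truncation sets from sp_{2∞} to sp_{2k}: B_{≤k} and B_{<k} are lower
sets (ideals) for the sp_{2∞}-Bruhat order, and their difference is B_k.
-/

open Finsupp

/-- B_{≤k}. -/
def BleK (n k : ℕ) : Set (Fin n → ℤ) :=
  {b | (∀ s : ℕ, 1 ≤ s → s < n → NC b (k : ℤ) s ≤ 0) ∧ NC b (k : ℤ) n = 0}

/-- B_{<k}. -/
def BltK (n k : ℕ) : Set (Fin n → ℤ) :=
  {b | b ∈ BleK n k ∧ ∃ s : ℕ, 1 ≤ s ∧ s < n ∧ NC b (k : ℤ) s < 0}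

/-- The sum of the coefficients of index `≥ k`. -/
noncomputable def tailSum (k : ℕ) : PC →+ ℤ :=
  Finsupp.liftAddHom fun j => if k ≤ j then AddMonoidHom.id ℤ else 0

lemma tailSum_epsC (k i : ℕ) : tailSum k (epsC i) = if k ≤ i then 1 else 0 := by
  unfold tailSum epsC
  rw [Finsupp.liftAddHom_apply_single]
  split_ifs <;> rfl

lemma tailSum_alphaC_nonpos {k : ℕ} (hk : 1 ≤ k) (i : ℕ) : tailSum k (alphaC i) ≤ 0 := by
  unfold alphaC
  split_ifs
  · rw [map_neg, map_nsmul, tailSum_epsC, if_neg (by omega)]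
    simp
  · rw [map_sub, tailSum_epsC, tailSum_epsC]
    split_ifs <;> omega

lemma DomC.tailSum_le {k : ℕ} (hk : 1 ≤ k) {lam mu : PC} (h : DomC lam mu) :
    tailSum k lam ≤ tailSum k mu := by
  obtain ⟨c, hc⟩ := h
  rw [← sub_nonpos, ← map_sub, hc, Finsupp.sum, map_sum]
  refine Finset.sum_nonpos fun i _ => ?_
  rw [map_zsmul, smul_eq_mul]
  exact mul_nonpos_of_nonneg_of_nonpos (Int.natCast_nonneg _) (tailSum_alphaC_nonpos hk i)

lemma tailSum_wtC {k n : ℕ} (hk : 1 ≤ k) (b : Fin n → ℤ) (r : Fin n) :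
    tailSum k (wtC b r) =
      (if (k : ℤ) < b r then 1 else 0) - (if b r ≤ -(k : ℤ) then 1 else 0) := by
  unfold wtC
  split_ifs <;> simp only [map_neg, tailSum_epsC] <;> split_ifs <;> omega

lemma NC_eq_tailSum {k n : ℕ} (hk : 1 ≤ k) (b : Fin n → ℤ) (s : ℕ) :
    NC b (k : ℤ) s = tailSum k (psumC (wtC b) s) := by
  unfold NC psumC
  simp only [map_sum, tailSum_wtC hk, Finset.sum_sub_distrib, Finset.sum_boole,
    Finset.filter_filter]

lemma BruhatC.NC_le {k n : ℕ} (hk : 1 ≤ k) {a b : Fin n → ℤ} (h : BruhatC a b) {s : ℕ}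
    (hs : 1 ≤ s) (hsn : s ≤ n) : NC a (k : ℤ) s ≤ NC b (k : ℤ) s := by
  rw [NC_eq_tailSum hk, NC_eq_tailSum hk]
  exact (h.2 s hs hsn).tailSum_le hk

lemma BruhatC.NC_eq {k n : ℕ} (hk : 1 ≤ k) {a b : Fin n → ℤ} (h : BruhatC a b) :
    NC a (k : ℤ) n = NC b (k : ℤ) n := by
  rw [NC_eq_tailSum hk, NC_eq_tailSum hk, h.1]

lemma psumC_succ {n : ℕ} (β : Fin n → PC) (r : Fin n) :
    psumC β (r + 1) = psumC β r + β r := by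
  have h : Finset.univ.filter (fun t : Fin n => (t : ℕ) < r + 1) =
      insert r (Finset.univ.filter fun t : Fin n => (t : ℕ) < r) := by
    ext t
    simp [Fin.ext_iff]
    omega
  rw [psumC, h, Finset.sum_insert (by simp), add_comm, psumC]

lemma NC_zero {n : ℕ} (b : Fin n → ℤ) (i : ℤ) : NC b i 0 = 0 := by
  simp [NC]

lemma mem_BleK_of_bruhatC {k n : ℕ} (hk : 1 ≤ k) {a b : Fin n → ℤ} (hb : b ∈ BleK n k)
    (h : BruhatC a b) : a ∈ BleK n k :=
  ⟨fun s hs hsn => (h.NC_le hk hs hsn.le).trans (hb.1 s hs hsn), (h.NC_eq hk).trans hb.2⟩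

theorem statement_11 (n : ℕ) (hn : 1 ≤ n) (k : ℕ) (hk : 1 ≤ k) :
    (∀ a b : Fin n → ℤ, b ∈ BleK n k → BruhatC a b → a ∈ BleK n k) ∧
    (∀ a b : Fin n → ℤ, b ∈ BltK n k → BruhatC a b → a ∈ BltK n k) ∧
    (BleK n k \ BltK n k =
      {b : Fin n → ℤ | ∀ r, -(k : ℤ) < b r ∧ b r ≤ (k : ℤ)}) := by
  refine ⟨fun a b hb h => mem_BleK_of_bruhatC hk hb h, ?_, ?_⟩
  · rintro a b ⟨hb, s, hs, hsn, hneg⟩ h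
    exact ⟨mem_BleK_of_bruhatC hk hb h, s, hs, hsn, (h.NC_le hk hs hsn.le).trans_lt hneg⟩
  · ext b
    constructor
    · rintro ⟨hb, hlt⟩ r
      have hzero : ∀ s ≤ n, NC b (k : ℤ) s = 0 := by
        intro s hs
        rcases Nat.eq_zero_or_pos s with rfl | hpos
        · exact NC_zero b k
        rcases hs.eq_or_lt with rfl | hsn
        · exact hb.2
        · exact le_antisymm (hb.1 s hpos hsn)
            (not_lt.mp fun hneg => hlt ⟨hb, s, hpos, hsn, hneg⟩)
      have h₁ := hzero (r + 1) r.isLt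
      rw [NC_eq_tailSum hk, psumC_succ, map_add, ← NC_eq_tailSum hk, hzero r r.isLt.le,
        tailSum_wtC hk] at h₁
      split_ifs at h₁ <;> omega
    · intro hb
      have hzero : ∀ s, NC b (k : ℤ) s = 0 := by
        intro s
        rw [NC_eq_tailSum hk, psumC, map_sum]
        refine Finset.sum_eq_zero fun r _ => ?_
        rw [tailSum_wtC hk, if_neg (not_lt.mpr (hb r).2), if_neg (not_le.mpr (hb r).1), sub_zero]
      exact ⟨⟨fun s _ _ => (hzero s).le, hzero n⟩, fun ⟨_, s, _, _, hneg⟩ => hneg.ne (hzero s)⟩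
end

section
/- Let n = n_0 + n_1 with n_0, n_1 ≥ 0, and let σ ∈ {+1,−1}^n be (+,…,+,−,…,−) with n_0 entries +1 followed by n_1 entries −1. Then: (i) B_{≤σ} := {b ∈ ℤ^n : N_{[1,s]}(b,0) ≤ σ_1 + ⋯ + σ_s for s = 1,…,n−1, and N_{[1,n]}(b,0) = n_0 − n_1} is equal to {a ∈ ℤ^n : N_{[1,n]}(a,0) = n_0 − n_1}; and (ii) B_σ := {b ∈ ℤ^n : b_r > 0 for r ≤ n_0 and b_r ≤ 0 for r > n_0} is an upper set (coideal) in ℤ^n with respect to the sp_{2∞}-Bruhat order ⪯, i.e. if a ∈ B_σ and a ⪯ b then b ∈ B_σ. -/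
/-!
STATEMENT 14: for σ = (+,…,+,−,…,−) with n₀ pluses followed by n₁ minuses,
(i) B_{≤σ} = {a : N_{[1,n]}(a,0) = n₀ − n₁}, and (ii) B_σ is an upper set (coideal)
for the sp_{2∞}-Bruhat order.
-/

open Finsupp

/-- The sign of an integer, with `0` counted as negative. -/
def signC (x : ℤ) : ℤ := if 0 < x then 1 else -1

lemma signC_le_one (x : ℤ) : signC x ≤ 1 := by
  unfold signC; split_ifs <;> omega

lemma neg_one_le_signC (x : ℤ) : -1 ≤ signC x := by
  unfold signC; split_ifs <;> omega

lemma signC_eq_one_iff {x : ℤ} : signC x = 1 ↔ 0 < x := by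
  unfold signC; split_ifs <;> simp <;> omega

lemma signC_eq_neg_one_iff {x : ℤ} : signC x = -1 ↔ x ≤ 0 := by
  unfold signC; split_ifs <;> simp <;> omega

lemma NC_zero_eq_sum_signC {n : ℕ} (b : Fin n → ℤ) (s : ℕ) :
    NC b 0 s = ∑ r ∈ Finset.univ.filter (fun r : Fin n => (r : ℕ) < s), signC (b r) := by
  simp only [NC, ← Finset.filter_filter, neg_zero, Finset.card_filter, Nat.cast_sum,
    ← Finset.sum_sub_distrib]
  refine Finset.sum_congr rfl fun r _ => ?_
  unfold signC
  split_ifs <;> omega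

/-- The sum of the coefficients of a weight. -/
noncomputable def degC : PC →+ ℤ := Finsupp.liftAddHom fun _ => AddMonoidHom.id ℤ

lemma degC_epsC (i : ℕ) : degC (epsC i) = 1 := by
  simp [degC, epsC]

lemma degC_alphaC_nonpos (i : ℕ) : degC (alphaC i) ≤ 0 := by
  unfold alphaC
  split_ifs <;> simp [degC_epsC]

lemma DomC.degC_le {lam mu : PC} (h : DomC lam mu) : degC lam ≤ degC mu := by
  obtain ⟨c, hc⟩ := h
  rw [← sub_nonpos, ← map_sub, hc, Finsupp.sum, map_sum]
  refine Finset.sum_nonpos fun i _ => ?_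
  rw [map_zsmul, smul_eq_mul]
  exact mul_nonpos_of_nonneg_of_nonpos (Nat.cast_nonneg _) (degC_alphaC_nonpos i)

lemma degC_psumC_wtC {n : ℕ} (b : Fin n → ℤ) (s : ℕ) :
    degC (psumC (wtC b) s) =
      ∑ r ∈ Finset.univ.filter (fun r : Fin n => (r : ℕ) < s), signC (b r) := by
  rw [psumC, map_sum]
  refine Finset.sum_congr rfl fun r _ => ?_
  unfold wtC signC
  split_ifs <;> simp [degC_epsC]

lemma filter_lt_self (n : ℕ) :
    Finset.univ.filter (fun r : Fin n => (r : ℕ) < n) = Finset.univ :=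
  Finset.filter_true_of_mem fun r _ => r.isLt

lemma sum_ite_val_lt (n0 n1 : ℕ) :
    ∑ r : Fin (n0 + n1), (if (r : ℕ) < n0 then (1 : ℤ) else -1) = n0 - n1 := by
  simp [Fin.sum_univ_add, sub_eq_add_neg]

theorem statement_14 (n0 n1 n : ℕ) (hn : n = n0 + n1)
    (σ : Fin n → ℤ) (hσ : ∀ r : Fin n, σ r = if (r : ℕ) < n0 then 1 else -1) :
    ({b : Fin n → ℤ |
        (∀ s : ℕ, 1 ≤ s → s < n →
            NC b 0 s ≤ ∑ r ∈ Finset.univ.filter (fun r : Fin n => (r : ℕ) < s), σ r) ∧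
        NC b 0 n = (n0 : ℤ) - (n1 : ℤ)} =
      {a : Fin n → ℤ | NC a 0 n = (n0 : ℤ) - (n1 : ℤ)}) ∧
    (∀ a b : Fin n → ℤ,
        (∀ r : Fin n, ((r : ℕ) < n0 → 0 < a r) ∧ (n0 ≤ (r : ℕ) → a r ≤ 0)) →
        BruhatC a b →
        (∀ r : Fin n, ((r : ℕ) < n0 → 0 < b r) ∧ (n0 ≤ (r : ℕ) → b r ≤ 0))) := by
  subst hn
  obtain rfl : σ = fun r : Fin (n0 + n1) => if (r : ℕ) < n0 then (1 : ℤ) else -1 := funext hσ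
  refine ⟨Set.ext fun b => ⟨fun h => h.2, fun h => ⟨fun s _ _ => ?_, h⟩⟩, fun a b ha hab => ?_⟩
  · rw [Set.mem_ofPred_eq, NC_zero_eq_sum_signC, filter_lt_self, ← sum_ite_val_lt] at h
    rw [NC_zero_eq_sum_signC]
    rcases le_or_gt s n0 with hs | hs
    · refine Finset.sum_le_sum fun r hr => ?_
      rw [if_pos ((Finset.mem_filter.1 hr).2.trans_le hs)]
      exact signC_le_one _
    · rw [← Finset.sum_filter_add_sum_filter_not _ (fun r : Fin (n0 + n1) => (r : ℕ) < s),
        ← Finset.sum_filter_add_sum_filter_not Finset.univ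
          (fun r : Fin (n0 + n1) => (r : ℕ) < s) (fun r => if (r : ℕ) < n0 then (1 : ℤ) else -1)]
        at h
      have hcompl : ∑ r ∈ Finset.univ.filter (fun r : Fin (n0 + n1) => ¬ (r : ℕ) < s),
            (if (r : ℕ) < n0 then (1 : ℤ) else -1) ≤
          ∑ r ∈ Finset.univ.filter (fun r : Fin (n0 + n1) => ¬ (r : ℕ) < s), signC (b r) := by
        refine Finset.sum_le_sum fun r hr => ?_
        have := (Finset.mem_filter.1 hr).2
        rw [if_neg (by omega)]
        exact neg_one_le_signC _
      linarith
  · have hpos : ∀ r : Fin (n0 + n1), (r : ℕ) < n0 → signC (b r) = signC (a r) := by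
      intro r hr
      have hdom := (hab.2 n0 (by omega) (by omega)).degC_le
      rw [degC_psumC_wtC, degC_psumC_wtC] at hdom
      have hle : ∀ i ∈ Finset.univ.filter (fun r : Fin (n0 + n1) => (r : ℕ) < n0),
          signC (b i) ≤ signC (a i) := by
        intro i hi
        rw [signC_eq_one_iff.2 ((ha i).1 (Finset.mem_filter.1 hi).2)]
        exact signC_le_one _
      exact (Finset.sum_eq_sum_iff_of_le hle).1 (le_antisymm (Finset.sum_le_sum hle) hdom) r
        (by simpa using hr)
    have hle : ∀ i ∈ Finset.univ, signC (a i) ≤ signC (b i) := by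
      intro i _
      rcases lt_or_ge (i : ℕ) n0 with hi | hi
      · exact (hpos i hi).ge
      · rw [signC_eq_neg_one_iff.2 ((ha i).2 hi)]
        exact neg_one_le_signC _
    have htot := congrArg degC hab.1
    rw [degC_psumC_wtC, degC_psumC_wtC, filter_lt_self] at htot
    have heq := (Finset.sum_eq_sum_iff_of_le hle).1 htot
    intro r
    rw [← signC_eq_one_iff, ← signC_eq_neg_one_iff, ← heq r (Finset.mem_univ r),
      signC_eq_one_iff, signC_eq_neg_one_iff]
    exact ha r
end

section
/- Let n = n_0 + n_1 with n_0, n_1 ≥ 0, and let σ ∈ {+1,−1}^n be (+,…,+,−,…,−) with n_0 entries +1 followed by n_1 entries −1. Define B_{n_0|n_1} := {b ∈ ℤ^n : exactly n_0 of the entries b_1,…,b_n are > 0 (and hence exactly n_1 are ≤ 0)} and B^#_{n_0|n_1} := {b ∈ ℤ^n : b_1,…,b_{n_0} > 0 and b_{n_0+1},…,b_n ≤ 0}. Then B_{n_0|n_1} = B_{≤σ} := {b : N_{[1,s]}(b,0) ≤ σ_1 + ⋯ + σ_s for s = 1,…,n−1, and N_{[1,n]}(b,0) = n_0 − n_1},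 and B^#_{n_0|n_1} is an upper set (coideal) in B_{n_0|n_1} with respect to the sp_{2∞}-Bruhat order: if a ∈ B^#_{n_0|n_1}, b ∈ B_{n_0|n_1}, and a ⪯ b, then b ∈ B^#_{n_0|n_1}. -/
/-!
STATEMENT 15: for σ = (+,…,+,−,…,−), B_{n₀|n₁} = B_{≤σ}, and B^#_{n₀|n₁} is an
upper set (coideal) in B_{n₀|n₁} for the sp_{2∞}-Bruhat order.
-/

open Finsupp

/-- B_{n₀|n₁}: tuples with exactly n₀ positive entries. -/
def Bmix (n n0 : ℕ) : Set (Fin n → ℤ) :=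
  {b | (Finset.univ.filter fun r : Fin n => 0 < b r).card = n0}

/-- B^#_{n₀|n₁}: the first n₀ entries positive and the remaining entries ≤ 0. -/
def Bsharp (n n0 : ℕ) : Set (Fin n → ℤ) :=
  {b | ∀ r : Fin n, ((r : ℕ) < n0 → 0 < b r) ∧ (n0 ≤ (r : ℕ) → b r ≤ 0)}

/-- A sum of signs over the first `s` indices counts the `+1`s twice, minus `s`. -/
theorem sum_sign_filter_lt {n s : ℕ} (hs : s ≤ n) (P : Fin n → Prop) [DecidablePred P] :
    ∑ r ∈ Finset.univ.filter (fun r : Fin n => (r : ℕ) < s), (if P r then (1 : ℤ) else -1) =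
      2 * ((Finset.univ.filter fun r : Fin n => (r : ℕ) < s ∧ P r).card : ℤ) - s := by
  have hcard : (Finset.univ.filter fun r : Fin n => (r : ℕ) < s).card = s := by
    rw [Fin.card_filter_val_lt, min_eq_right hs]
  have hsplit := Finset.card_filter_add_card_filter_not
    (s := Finset.univ.filter fun r : Fin n => (r : ℕ) < s) P
  rw [Finset.sum_ite, Finset.sum_const, Finset.sum_const]
  simp only [nsmul_eq_mul, mul_one, mul_neg, Finset.filter_filter] at hsplit ⊢
  omega

theorem NC_zero_eq_sum {n : ℕ} (b : Fin n → ℤ) (s : ℕ) :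
    NC b 0 s =
      ∑ r ∈ Finset.univ.filter (fun r : Fin n => (r : ℕ) < s),
        (if 0 < b r then (1 : ℤ) else -1) := by
  rw [Finset.sum_ite, Finset.filter_filter, Finset.filter_filter]
  simp [NC, sub_eq_add_neg]

theorem NC_zero_eq {n s : ℕ} (hs : s ≤ n) (b : Fin n → ℤ) :
    NC b 0 s = 2 * ((Finset.univ.filter fun r : Fin n => (r : ℕ) < s ∧ 0 < b r).card : ℤ) - s := by
  rw [NC_zero_eq_sum, sum_sign_filter_lt hs]

theorem degree_psumC_wtC {n : ℕ} (b : Fin n → ℤ) (s : ℕ) :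
    Finsupp.degree (psumC (wtC b) s) = NC b 0 s := by
  rw [NC_zero_eq_sum, psumC, map_sum]
  refine Finset.sum_congr rfl fun r _ => ?_
  unfold wtC epsC
  split_ifs <;> simp [Finsupp.degree_single]

theorem degree_alphaC_nonpos (i : ℕ) : Finsupp.degree (alphaC i) ≤ 0 := by
  unfold alphaC epsC
  split_ifs <;> simp [Finsupp.degree_single]

/-- The total degree is antitone in the dominance order, as only `α_0` has nonzero degree. -/
theorem DomC.degree_le {lam mu : PC} (h : DomC lam mu) :
    Finsupp.degree lam ≤ Finsupp.degree mu := by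
  obtain ⟨c, hc⟩ := h
  rw [← sub_nonpos, ← map_sub, hc, Finsupp.sum, map_sum]
  refine Finset.sum_nonpos fun i _ => ?_
  rw [map_zsmul, smul_eq_mul]
  exact mul_nonpos_of_nonneg_of_nonpos (Int.natCast_nonneg _) (degree_alphaC_nonpos i)

theorem BruhatC.NC_zero_le {n : ℕ} {a b : Fin n → ℤ} (h : BruhatC a b) {s : ℕ} (hs : s ≤ n) :
    NC a 0 s ≤ NC b 0 s := by
  rcases Nat.eq_zero_or_pos s with rfl | hpos
  · simp [NC]
  · rw [← degree_psumC_wtC, ← degree_psumC_wtC]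
    exact (h.2 s hpos hs).degree_le

theorem mem_Bmix_iff_NC {n0 n1 n : ℕ} (hn : n = n0 + n1) (b : Fin n → ℤ) :
    b ∈ Bmix n n0 ↔ NC b 0 n = (n0 : ℤ) - (n1 : ℤ) := by
  rw [NC_zero_eq le_rfl]
  simp only [Bmix, Set.mem_ofPred_eq, Fin.is_lt, true_and]
  omega

theorem mem_Bsharp_of_card {n0 n : ℕ} (hn : n0 ≤ n) {b : Fin n → ℤ} (hb : b ∈ Bmix n n0)
    (hcard : n0 ≤ (Finset.univ.filter fun r : Fin n => (r : ℕ) < n0 ∧ 0 < b r).card) :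
    b ∈ Bsharp n n0 := by
  have hb' : (Finset.univ.filter fun r : Fin n => 0 < b r).card = n0 := hb
  have hlt : (Finset.univ.filter fun r : Fin n => (r : ℕ) < n0).card = n0 := by
    rw [Fin.card_filter_val_lt, min_eq_right hn]
  have h1 : (Finset.univ.filter fun r : Fin n => (r : ℕ) < n0 ∧ 0 < b r) =
      Finset.univ.filter fun r : Fin n => (r : ℕ) < n0 :=
    Finset.eq_of_subset_of_card_le (Finset.monotone_filter_right _ fun _ _ h => h.1) (by omega)
  have h2 : (Finset.univ.filter fun r : Fin n => (r : ℕ) < n0 ∧ 0 < b r) =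
      Finset.univ.filter fun r : Fin n => 0 < b r :=
    Finset.eq_of_subset_of_card_le (Finset.monotone_filter_right _ fun _ _ h => h.2) (by omega)
  intro r
  have e1 := Finset.ext_iff.1 h1 r
  have e2 := Finset.ext_iff.1 h2 r
  simp only [Finset.mem_filter, Finset.mem_univ, true_and] at e1 e2
  refine ⟨fun h => (e1.2 h).2, fun h => ?_⟩
  by_contra! hpos
  exact absurd (e2.2 hpos).1 (by omega)

theorem statement_15 (n0 n1 n : ℕ) (hn : n = n0 + n1)
    (σ : Fin n → ℤ) (hσ : ∀ r : Fin n, σ r = if (r : ℕ) < n0 then 1 else -1) :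
    (Bmix n n0 =
      {b : Fin n → ℤ |
        (∀ s : ℕ, 1 ≤ s → s < n →
            NC b 0 s ≤ ∑ r ∈ Finset.univ.filter (fun r : Fin n => (r : ℕ) < s), σ r) ∧
        NC b 0 n = (n0 : ℤ) - (n1 : ℤ)}) ∧
    (∀ a b : Fin n → ℤ, a ∈ Bsharp n n0 → b ∈ Bmix n n0 → BruhatC a b →
        b ∈ Bsharp n n0) := by
  refine ⟨?_, fun a b ha hb hab => ?_⟩
  · ext b
    rw [mem_Bmix_iff_NC hn b, Set.mem_ofPred_eq, iff_and_self]
    intro hb s _ hs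
    have hmix : (Finset.univ.filter fun r : Fin n => 0 < b r).card = n0 :=
      (mem_Bmix_iff_NC hn b).2 hb
    simp only [hσ]
    rw [NC_zero_eq hs.le, sum_sign_filter_lt hs.le]
    have hmin : (Finset.univ.filter fun r : Fin n => (r : ℕ) < s ∧ (r : ℕ) < n0).card =
        min s n0 := by
      simp only [← lt_min_iff]
      rw [Fin.card_filter_val_lt]
      omega
    have hle : (Finset.univ.filter fun r : Fin n => (r : ℕ) < s ∧ 0 < b r).card ≤ n0 :=
      hmix ▸ Finset.card_le_card (Finset.monotone_filter_right _ fun _ _ h => h.2)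
    have hle' : (Finset.univ.filter fun r : Fin n => (r : ℕ) < s ∧ 0 < b r).card ≤
        (Finset.univ.filter fun r : Fin n => (r : ℕ) < s).card :=
      Finset.card_le_card (Finset.monotone_filter_right _ fun _ _ h => h.1)
    rw [Fin.card_filter_val_lt] at hle'
    omega
  · have hn0 : n0 ≤ n := by omega
    refine mem_Bsharp_of_card hn0 hb ?_
    have hNC := hab.NC_zero_le hn0
    have hcard : (Finset.univ.filter fun r : Fin n => (r : ℕ) < n0 ∧ 0 < a r).card = n0 := by
      rw [Finset.filter_congr fun r _ => and_iff_left_of_imp (ha r).1, Fin.card_filter_val_lt,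
        min_eq_right hn0]
    rw [NC_zero_eq hn0, NC_zero_eq hn0] at hNC
    omega
end

section
/- Let n = n_0 + n_1 with n_0, n_1 ≥ 0, and let σ ∈ {+1,−1}^n be (+,…,+,−,…,−) with n_0 entries +1 followed by n_1 entries −1; let ⪯_σ be the sl_∞-Bruhat order on ℤ^n associated to σ. Define B_0 := {b ∈ ℤ^n : b_1,…,b_n > 0}, B^{n_0|n_1} := {b ∈ ℤ^n : b_1 > ⋯ > b_{n_0} and b_{n_0+1} < ⋯ < b_n}, and B_0^{n_0|n_1} := B^{n_0|n_1} ∩ B_0. Then B_0 is an upper set (coideal) in (ℤ^n, ⪯_σ), and B_0^{n_0|n_1} is an upper set (coideal) in (B^{n_0|n_1}, ⪯_σ), i.e. if a ∈ B_0^{n_0|n_1}, b ∈ B^{n_0|n_1}, and a ⪯_σ b, then b ∈ B_0^{n_0|n_1}. -/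
/-!
STATEMENT 16: for σ = (+,…,+,−,…,−), B₀ is an upper set (coideal) in (ℤ^n, ⪯_σ),
and B₀^{n₀|n₁} is an upper set (coideal) in (B^{n₀|n₁}, ⪯_σ).
-/

open Finsupp

/-- `N^σ_{[1,s]}(b,i) = #{r ≤ s : b_r > i, σ_r = +1} − #{r ≤ s : b_r > i, σ_r = −1}`. -/
def NA {n : ℕ} (σ b : Fin n → ℤ) (i : ℤ) (s : ℕ) : ℤ :=
  ((Finset.univ.filter fun r : Fin n => (r : ℕ) < s ∧ i < b r ∧ σ r = 1).card : ℤ) -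
  ((Finset.univ.filter fun r : Fin n => (r : ℕ) < s ∧ i < b r ∧ σ r = -1).card : ℤ)

/-- B^{n₀|n₁}: the first n₀ entries strictly decreasing and the remaining entries
strictly increasing. -/
def Bnn (n n0 : ℕ) : Set (Fin n → ℤ) :=
  {b | (∀ r s : Fin n, r < s → (s : ℕ) < n0 → b s < b r) ∧
       (∀ r s : Fin n, r < s → n0 ≤ (r : ℕ) → b r < b s)}

/-- The sum of the coefficients of `lam` at the indices `≤ i`. -/
noncomputable def lowSumA (i : ℤ) : PA →+ ℤ :=
  Finsupp.liftAddHom fun j => if j ≤ i then AddMonoidHom.id ℤ else 0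

lemma lowSumA_epsA (i j : ℤ) : lowSumA i (epsA j) = if j ≤ i then 1 else 0 := by
  by_cases h : j ≤ i <;> simp [lowSumA, epsA, h]

lemma lowSumA_alphaA_nonneg (i j : ℤ) : 0 ≤ lowSumA i (alphaA j) := by
  rw [alphaA, map_sub, lowSumA_epsA, lowSumA_epsA]
  split_ifs <;> omega

lemma DomA.lowSumA_le {lam mu : PA} (h : DomA lam mu) (i : ℤ) :
    lowSumA i mu ≤ lowSumA i lam := by
  obtain ⟨c, hc⟩ := h
  rw [← sub_nonneg, ← map_sub, hc, Finsupp.sum, map_sum]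
  refine Finset.sum_nonneg fun j _ => ?_
  rw [map_zsmul, smul_eq_mul]
  exact mul_nonneg (Int.natCast_nonneg _) (lowSumA_alphaA_nonneg i j)

lemma lowSumA_psumA_wtA {n : ℕ} (σ b : Fin n → ℤ) (i : ℤ) (s : ℕ) :
    lowSumA i (psumA (wtA σ b) s) =
      ∑ r ∈ Finset.univ.filter (fun r : Fin n => (r : ℕ) < s),
        σ r * if b r ≤ i then 1 else 0 := by
  simp only [psumA, wtA, map_sum, map_zsmul, lowSumA_epsA, smul_eq_mul]

lemma lowSumA_psumA_wtA_eq_zero {n : ℕ} (σ : Fin n → ℤ) {a : Fin n → ℤ} (ha : a ∈ B0set n)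
    (s : ℕ) : lowSumA 0 (psumA (wtA σ a) s) = 0 := by
  rw [lowSumA_psumA_wtA]
  refine Finset.sum_eq_zero fun r _ => ?_
  rw [if_neg (not_le.mpr (ha r)), mul_zero]

/-- Positivity of all entries is preserved when going up in the Bruhat order attached to the
sign sequence `(+,…,+,−,…,−)`. -/
lemma BruhatA.mem_B0set {n n0 : ℕ} (hn : n0 ≤ n) {σ : Fin n → ℤ}
    (hσ : ∀ r : Fin n, σ r = if (r : ℕ) < n0 then 1 else -1) {a b : Fin n → ℤ}
    (ha : a ∈ B0set n) (hab : BruhatA σ a b) : b ∈ B0set n := by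
  have h_pos : ∀ r : Fin n, (r : ℕ) < n0 → 0 < b r := by
    intro r hr
    have h := (hab.2 n0 (by omega) hn).lowSumA_le 0
    rw [lowSumA_psumA_wtA_eq_zero σ ha, lowSumA_psumA_wtA] at h
    by_contra hb
    have hle : σ r * (if b r ≤ 0 then 1 else 0) ≤ _ :=
      Finset.single_le_sum (f := fun r => σ r * if b r ≤ 0 then 1 else 0)
        (s := Finset.univ.filter (fun r : Fin n => (r : ℕ) < n0))
        (fun t ht => by
          rw [hσ, if_pos (Finset.mem_filter.mp ht).2]
          split_ifs <;> norm_num)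
        (Finset.mem_filter.mpr ⟨Finset.mem_univ r, hr⟩)
    rw [hσ, if_pos hr, if_pos (not_lt.mp hb)] at hle
    linarith
  have h_sum : ∑ r : Fin n, (if b r ≤ 0 then (1 : ℤ) else 0) = 0 := by
    have h := congrArg (lowSumA 0) hab.1
    rw [lowSumA_psumA_wtA_eq_zero σ ha, lowSumA_psumA_wtA,
      Finset.filter_true_of_mem fun r _ => r.isLt] at h
    rw [← neg_eq_zero, ← Finset.sum_neg_distrib]
    refine Eq.trans ?_ h.symm
    refine Finset.sum_congr rfl fun r _ => ?_
    by_cases hr : (r : ℕ) < n0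
    · simp [not_le.mpr (h_pos r hr)]
    · rw [hσ, if_neg hr, neg_one_mul]
  intro r
  have hr := (Finset.sum_eq_zero_iff_of_nonneg fun t _ => by split_ifs <;> norm_num).mp
    h_sum r (Finset.mem_univ r)
  by_contra hb
  rw [if_pos (not_lt.mp hb)] at hr
  exact one_ne_zero hr

theorem statement_16 (n0 n1 n : ℕ) (hn : n = n0 + n1)
    (σ : Fin n → ℤ) (hσ : ∀ r : Fin n, σ r = if (r : ℕ) < n0 then 1 else -1) :
    (∀ a b : Fin n → ℤ, a ∈ B0set n → BruhatA σ a b → b ∈ B0set n) ∧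
    (∀ a b : Fin n → ℤ, a ∈ Bnn n n0 ∩ B0set n → b ∈ Bnn n n0 → BruhatA σ a b →
        b ∈ Bnn n n0 ∩ B0set n) := by
  have hle : n0 ≤ n := by omega
  exact ⟨fun _ _ ha hab => hab.mem_B0set hle hσ ha,
    fun _ _ ha hb hab => ⟨hb, hab.mem_B0set hle hσ ha.2⟩⟩
end
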